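/- arXiv:2603.12159 — 2 statements merged into one kernel-verified Lean document; each statement's English description precedes it below -/
import Mathlib

section
/- The sequence (C_{2d})_{d≥1} is decreasing in d, and its limit as d → ∞ equals (2/π)·( γ + log(4/π) + ∫₀¹ (log I₀(u))/u² du + ∫₁^∞ (log I₀(u) − u)/u² du ), where γ is the Euler–Mascheroni constant. -/
open scoped BigOperators Classical

noncomputable section

/-- `α_m(u) = log((1/m) ∑_{k=0}^{m-1} exp(u cos(2kπ/m)))`. -/
def alphad (m : ℕ) (u : ℝ) : ℝ :=
  Real.log ((1 / m : ℝ) * ∑ k ∈ Finset.range m, Real.exp (u * Real.cos (2 * k * Real.pi / m)))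

/-- The constant `C_m = (2/π)(γ + log(4/π) + ∫₁^∞ (α_m(u) − u)/u² du)
+ (2/π) ∫₀¹ α_m(u)/u² du`. -/
def Cconst (m : ℕ) : ℝ :=
  2 / Real.pi * (Real.eulerMascheroniConstant + Real.log (4 / Real.pi)
      + ∫ u in Set.Ioi (1:ℝ), (alphad m u - u) / u ^ 2)
    + 2 / Real.pi * ∫ u in (0:ℝ)..1, alphad m u / u ^ 2

/-- The modified Bessel function of the first kind of order `0`:
`I₀(x) = ∑_{k≥0} (x/2)^{2k}/(k!)²`. -/
def I0 (x : ℝ) : ℝ := ∑' k : ℕ, (x / 2) ^ (2 * k) / (Nat.factorial k : ℝ) ^ 2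

theorem choose_two_mul_le_of_le {p a b : ℕ} (hab : a ≤ b) (hb : b ≤ p) :
    (2 * p).choose a ≤ (2 * p).choose b := by
  induction b, hab using Nat.le_induction with
  | base => exact le_rfl
  | succ n _ ih =>
    exact (ih (by omega)).trans (Nat.choose_le_succ_of_lt_half_left (by omega))

theorem choose_two_mul_le_of_natAbs_le {p a b : ℕ} (ha : a ≤ 2 * p) (hb : b ≤ 2 * p)
    (h : ((b : ℤ) - p).natAbs ≤ ((a : ℤ) - p).natAbs) :
    (2 * p).choose a ≤ (2 * p).choose b := by
  rcases le_total a p with h1 | h1 <;> rcases le_total b p with h2 | h2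
  · exact choose_two_mul_le_of_le (by omega) h2
  · rw [← Nat.choose_symm hb]
    exact choose_two_mul_le_of_le (by omega) (by omega)
  · rw [← Nat.choose_symm ha]
    exact choose_two_mul_le_of_le (by omega) h2
  · rw [← Nat.choose_symm ha, ← Nat.choose_symm hb]
    exact choose_two_mul_le_of_le (by omega) (by omega)

/-- The sum of the binomial coefficients `(2p).choose j` over `j ≡ p` modulo `d`. -/
def chooseSum (d p : ℕ) : ℕ :=
  ∑ j ∈ (Finset.range (2 * p + 1)).filter (fun j : ℕ => (d : ℤ) ∣ (j : ℤ) - p), (2 * p).choose j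

theorem chooseSum_succ_le {d : ℕ} (hd : 1 ≤ d) (p : ℕ) : chooseSum (d + 1) p ≤ chooseSum d p := by
  set φ : ℕ → ℕ := fun j => ((j : ℤ) - ((j : ℤ) - p) / ((d + 1 : ℕ) : ℤ)).toNat with hφ
  have key : ∀ j ∈ (Finset.range (2 * p + 1)).filter
      (fun j : ℕ => ((d + 1 : ℕ) : ℤ) ∣ (j : ℤ) - p),
      ∃ i : ℤ, (j : ℤ) = p + (d + 1) * i ∧ (φ j : ℤ) = p + d * i ∧ φ j ≤ 2 * p ∧
        ((φ j : ℤ) - p).natAbs ≤ ((j : ℤ) - p).natAbs := by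
    intro j hj
    obtain ⟨hj, i, hi⟩ := Finset.mem_filter.1 hj
    have hj := Finset.mem_range.1 hj
    have hdiv : ((j : ℤ) - p) / ((d + 1 : ℕ) : ℤ) = i := by
      rw [hi]; exact Int.mul_ediv_cancel_left _ (by positivity)
    push_cast at hi
    have e : (d + 1 : ℤ) * i = d * i + i := by ring
    have hval : (j : ℤ) - i = p + d * i := by linarith
    have hs : (0 ≤ i ∧ 0 ≤ (d : ℤ) * i) ∨ (i ≤ 0 ∧ (d : ℤ) * i ≤ 0) := by
      rcases le_total 0 i with h | h
      · exact Or.inl ⟨h, by positivity⟩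
      · exact Or.inr ⟨h, mul_nonpos_of_nonneg_of_nonpos (by positivity) h⟩
    have hφj : (φ j : ℤ) = p + d * i := by
      simp only [hφ, hdiv]
      rw [← hval]
      apply Int.toNat_of_nonneg
      omega
    refine ⟨i, by linarith, hφj, by omega, by omega⟩
  have hinj : Set.InjOn φ ((Finset.range (2 * p + 1)).filter
      (fun j : ℕ => ((d + 1 : ℕ) : ℤ) ∣ (j : ℤ) - p) : Finset ℕ) := by
    intro a ha b hb hab
    obtain ⟨i, hi, hi', -⟩ := key a (Finset.mem_coe.1 ha)
    obtain ⟨k, hk, hk', -⟩ := key b (Finset.mem_coe.1 hb)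
    have : (d : ℤ) * i = d * k := by
      rw [hab] at hi'; linarith
    have hik : i = k := mul_left_cancel₀ (by positivity) this
    subst hik
    exact_mod_cast hi.trans hk.symm
  calc chooseSum (d + 1) p
      ≤ ∑ j ∈ (Finset.range (2 * p + 1)).filter
          (fun j : ℕ => ((d + 1 : ℕ) : ℤ) ∣ (j : ℤ) - p), (2 * p).choose (φ j) := by
        refine Finset.sum_le_sum fun j hj => ?_
        obtain ⟨i, hi, hi', h1, h2⟩ := key j hj
        have := Finset.mem_range.1 (Finset.mem_filter.1 hj).1
        exact choose_two_mul_le_of_natAbs_le (by omega) h1 h2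
    _ = ∑ j ∈ ((Finset.range (2 * p + 1)).filter
          (fun j : ℕ => ((d + 1 : ℕ) : ℤ) ∣ (j : ℤ) - p)).image φ, (2 * p).choose j :=
        (Finset.sum_image (f := fun j => (2 * p).choose j) hinj).symm
    _ ≤ chooseSum d p := by
        refine Finset.sum_le_sum_of_subset fun j hj => ?_
        obtain ⟨k, hk, rfl⟩ := Finset.mem_image.1 hj
        obtain ⟨i, hi, hi', h1, -⟩ := key k hk
        refine Finset.mem_filter.2 ⟨Finset.mem_range.2 (by omega), i, by linarith⟩

theorem chooseSum_of_lt {d p : ℕ} (h : p < d) : chooseSum d p = (2 * p).choose p := by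
  rw [chooseSum, Finset.sum_eq_single_of_mem p]
  · simp; omega
  · intro j hj hjp
    obtain ⟨hj, hdvd⟩ := Finset.mem_filter.1 hj
    have hj := Finset.mem_range.1 hj
    have := Int.eq_zero_of_abs_lt_dvd hdvd (by rw [abs_lt]; constructor <;> omega)
    omega

theorem choose_lt_chooseSum_self {d : ℕ} (hd : 1 ≤ d) : (2 * d).choose d < chooseSum d d := by
  have hsub : ({d, 2 * d} : Finset ℕ) ⊆
      (Finset.range (2 * d + 1)).filter (fun j : ℕ => (d : ℤ) ∣ (j : ℤ) - d) := by
    intro j hj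
    rcases Finset.mem_insert.1 hj with rfl | hj
    · simp; omega
    · rw [Finset.mem_singleton.1 hj]
      refine Finset.mem_filter.2 ⟨by simp, 1, by push_cast; ring⟩
  have := Finset.sum_le_sum_of_subset (f := fun j => (2 * d).choose j) hsub
  rw [Finset.sum_pair (by omega), Nat.choose_self] at this
  exact this

theorem choose_le_chooseSum (d p : ℕ) : (2 * p).choose p ≤ chooseSum d p := by
  refine Finset.single_le_sum (f := fun j => (2 * p).choose j) (fun _ _ => Nat.zero_le _) ?_
  simp; omega

theorem chooseSum_le_four_pow (d p : ℕ) : chooseSum d p ≤ 4 ^ p := by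
  calc chooseSum d p ≤ ∑ j ∈ Finset.range (2 * p + 1), (2 * p).choose j :=
        Finset.sum_le_sum_of_subset (Finset.filter_subset _ _)
    _ = 4 ^ p := by rw [Nat.sum_range_choose, pow_mul]; norm_num

theorem sum_rootsOfUnity_zpow {m : ℕ} {ζ : ℂ} (hζ : IsPrimitiveRoot ζ m) (l : ℤ) :
    ∑ k ∈ Finset.range m, (ζ ^ l) ^ k = if (m : ℤ) ∣ l then (m : ℂ) else 0 := by
  split_ifs with h
  · rw [(hζ.zpow_eq_one_iff_dvd l).2 h]; simp
  · have h1 : ζ ^ l ≠ 1 := fun e => h ((hζ.zpow_eq_one_iff_dvd l).1 e)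
    rw [geom_sum_eq h1, ← zpow_natCast, ← zpow_mul, mul_comm, zpow_mul, zpow_natCast,
      hζ.pow_eq_one]
    simp

/-- Averages of powers of the cosine over the `m`-th roots of unity. -/
theorem sum_cos_pow {m : ℕ} (hm : m ≠ 0) (n : ℕ) :
    (1 / m : ℝ) * ∑ k ∈ Finset.range m, Real.cos (2 * k * Real.pi / m) ^ n =
      (∑ j ∈ (Finset.range (n + 1)).filter (fun j : ℕ => (m : ℤ) ∣ 2 * (j : ℤ) - n),
        (n.choose j : ℝ)) / 2 ^ n := by
  have hmC : (m : ℂ) ≠ 0 := by exact_mod_cast hm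
  have hζ := Complex.isPrimitiveRoot_exp m hm
  set ζ := Complex.exp (2 * Real.pi * Complex.I / m) with hζdef
  have hζ0 : ζ ≠ 0 := Complex.exp_ne_zero _
  have hcos : ∀ k : ℕ, (2 : ℂ) ^ n * (Complex.cos (2 * k * Real.pi / m)) ^ n =
      ∑ j ∈ Finset.range (n + 1), (n.choose j : ℂ) * (ζ ^ (2 * (j : ℤ) - n)) ^ k := by
    intro k
    rw [← mul_pow, Complex.two_cos]
    have e1 : Complex.exp (2 * k * Real.pi / m * Complex.I) = ζ ^ k := by
      rw [hζdef, ← Complex.exp_nat_mul]; congr 1; ring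
    have e2 : Complex.exp (-(2 * k * Real.pi / m) * Complex.I) = (ζ ^ k)⁻¹ := by
      rw [← e1, ← Complex.exp_neg]; congr 1; ring
    rw [e1, e2, add_pow]
    refine Finset.sum_congr rfl fun j hj => ?_
    have hj := Finset.mem_range.1 hj
    rw [mul_comm]
    congr 1
    have : (2 * (j : ℤ) - n) = (j : ℤ) - ((n - j : ℕ) : ℤ) := by omega
    rw [this, zpow_sub₀ hζ0, zpow_natCast, zpow_natCast, div_pow, inv_pow, ← pow_mul, ← pow_mul,
      ← pow_mul, ← pow_mul, mul_comm k, mul_comm k, div_eq_mul_inv]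
  rw [eq_div_iff (by positivity)]
  apply Complex.ofReal_injective
  push_cast
  calc (1 / m : ℂ) * (∑ k ∈ Finset.range m, Complex.cos (2 * k * Real.pi / m) ^ n) * 2 ^ n
      = (1 / m : ℂ) * ∑ k ∈ Finset.range m, (2 : ℂ) ^ n * Complex.cos (2 * k * Real.pi / m) ^ n := by
        rw [← Finset.mul_sum]; ring
    _ = (1 / m : ℂ) * ∑ j ∈ Finset.range (n + 1), (n.choose j : ℂ) *
          ∑ k ∈ Finset.range m, (ζ ^ (2 * (j : ℤ) - n)) ^ k := by
        simp_rw [hcos, Finset.mul_sum]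
        rw [Finset.sum_comm]
    _ = _ := by
        simp_rw [sum_rootsOfUnity_zpow hζ]
        rw [Finset.sum_filter, Finset.mul_sum]
        refine Finset.sum_congr rfl fun j _ => ?_
        split_ifs
        · field_simp
        · simp

theorem sum_cos_pow_odd {d : ℕ} (hd : 1 ≤ d) {n : ℕ} (hn : Odd n) :
    (1 / (2 * d : ℕ) : ℝ) * ∑ k ∈ Finset.range (2 * d),
      Real.cos (2 * k * Real.pi / (2 * d : ℕ)) ^ n = 0 := by
  rw [sum_cos_pow (by omega), Finset.filter_false_of_mem]
  · simp
  · rintro j - ⟨c, hc⟩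
    obtain ⟨r, rfl⟩ := hn
    push_cast at hc
    rw [mul_assoc] at hc
    omega

theorem sum_cos_pow_even {d : ℕ} (hd : 1 ≤ d) (p : ℕ) :
    (1 / (2 * d : ℕ) : ℝ) * ∑ k ∈ Finset.range (2 * d),
      Real.cos (2 * k * Real.pi / (2 * d : ℕ)) ^ (2 * p) = chooseSum d p / 4 ^ p := by
  rw [sum_cos_pow (by omega), chooseSum, pow_mul]
  push_cast
  congr 1
  · refine Finset.sum_congr (Finset.filter_congr fun j _ => ?_) fun _ _ => rfl
    rw [← mul_sub]
    exact mul_dvd_mul_iff_left (by norm_num)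
  · norm_num

/-- The average of `exp (u cos θ)` over the `m`-th roots of unity. -/
def expCosMean (m : ℕ) (u : ℝ) : ℝ :=
  (1 / m : ℝ) * ∑ k ∈ Finset.range m, Real.exp (u * Real.cos (2 * k * Real.pi / m))

theorem hasSum_expCosMean {d : ℕ} (hd : 1 ≤ d) (u : ℝ) :
    HasSum (fun p : ℕ => u ^ (2 * p) / (2 * p).factorial * (chooseSum d p / 4 ^ p))
      (expCosMean (2 * d) u) := by
  have h1 : HasSum (fun n : ℕ => u ^ n / n.factorial * ((1 / (2 * d : ℕ) : ℝ) *
      ∑ k ∈ Finset.range (2 * d), Real.cos (2 * k * Real.pi / (2 * d : ℕ)) ^ n))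
      (expCosMean (2 * d) u) := by
    have h : HasSum _ (expCosMean (2 * d) u) := (hasSum_sum (s := Finset.range (2 * d)) fun k _ => by
      have := NormedSpace.expSeries_div_hasSum_exp
        (u * Real.cos (2 * k * Real.pi / (2 * d : ℕ)))
      rwa [← congrFun Real.exp_eq_exp_ℝ] at this).mul_left _
    convert h using 2 with n
    simp_rw [Finset.mul_sum]
    refine Finset.sum_congr rfl fun k _ => ?_
    rw [mul_pow]; ring
  have hinj : Function.Injective (fun p : ℕ => 2 * p) := fun a b h => by simpa using h
  have h2 := (hinj.hasSum_iff (f := fun n : ℕ => u ^ n / n.factorial * ((1 / (2 * d : ℕ) : ℝ) *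
      ∑ k ∈ Finset.range (2 * d), Real.cos (2 * k * Real.pi / (2 * d : ℕ)) ^ n)) (by
    intro n hn
    have : Odd n := by
      rw [← Nat.not_even_iff_odd]
      rintro ⟨r, rfl⟩
      exact hn ⟨r, by simp; ring⟩
    rw [sum_cos_pow_odd hd this, mul_zero])).2 h1
  refine h2.congr_fun fun p => ?_
  simp only [Function.comp]
  rw [sum_cos_pow_even hd]

theorem expCosMean_pos {m : ℕ} (hm : m ≠ 0) (u : ℝ) : 0 < expCosMean m u :=
  mul_pos (by positivity) (Finset.sum_pos (fun _ _ => Real.exp_pos _) (by simpa using hm))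

theorem continuous_expCosMean (m : ℕ) : Continuous (expCosMean m) := by
  unfold expCosMean
  fun_prop

theorem alphad_eq_log (m : ℕ) (u : ℝ) : alphad m u = Real.log (expCosMean m u) := rfl

theorem continuous_alphad {m : ℕ} (hm : m ≠ 0) : Continuous (alphad m) :=
  (continuous_expCosMean m).log fun u => (expCosMean_pos hm u).ne'

theorem expCosMean_succ_lt {d : ℕ} (hd : 1 ≤ d) {u : ℝ} (hu : u ≠ 0) :
    expCosMean (2 * (d + 1)) u < expCosMean (2 * d) u := by
  have hpos : ∀ p : ℕ, 0 < u ^ (2 * p) := fun p => (even_two_mul p).pow_pos hu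
  refine hasSum_lt (i := d) (fun p => ?_) ?_ (hasSum_expCosMean (by omega) u)
    (hasSum_expCosMean hd u)
  · have h : (chooseSum (d + 1) p : ℝ) ≤ chooseSum d p := by
      exact_mod_cast chooseSum_succ_le hd p
    have := hpos p
    dsimp only
    gcongr
  · have h : (chooseSum (d + 1) d : ℝ) < chooseSum d d := by
      rw [chooseSum_of_lt (Nat.lt_succ_self d)]
      exact_mod_cast choose_lt_chooseSum_self hd
    have := hpos d
    gcongr

theorem one_le_expCosMean {d : ℕ} (hd : 1 ≤ d) (u : ℝ) : 1 ≤ expCosMean (2 * d) u := by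
  have h := le_hasSum (hasSum_expCosMean hd u) 0 fun p _ => by
    rw [pow_mul]; positivity
  have h0 : (1 : ℝ) ≤ chooseSum d 0 := by exact_mod_cast choose_le_chooseSum d 0
  simp at h
  linarith

theorem expCosMean_le_cosh {d : ℕ} (hd : 1 ≤ d) (u : ℝ) :
    expCosMean (2 * d) u ≤ Real.cosh u := by
  refine hasSum_le (fun p => ?_) (hasSum_expCosMean hd u) (Real.hasSum_cosh u)
  have h : (chooseSum d p : ℝ) ≤ 4 ^ p := by exact_mod_cast chooseSum_le_four_pow d p
  refine mul_le_of_le_one_right (by rw [pow_mul]; positivity) ?_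
  exact div_le_one_of_le₀ h (by positivity)

theorem sinh_div_le_expCosMean {d : ℕ} (hd : 1 ≤ d) {u : ℝ} (hu : 0 < u) :
    Real.sinh u / u ≤ expCosMean (2 * d) u := by
  refine hasSum_le (fun p => ?_) ((Real.hasSum_sinh u).div_const u) (hasSum_expCosMean hd u)
  have h : (4 : ℝ) ^ p ≤ (2 * p + 1) * chooseSum d p := by
    exact_mod_cast (Nat.four_pow_le_two_mul_add_one_mul_central_binom p).trans
      (Nat.mul_le_mul_left _ (choose_le_chooseSum d p))
  have h' : 1 / (2 * p + 1 : ℝ) ≤ chooseSum d p / 4 ^ p := by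
    rw [div_le_div_iff₀ (by positivity) (by positivity)]
    linarith
  calc u ^ (2 * p + 1) / ((2 * p + 1).factorial : ℝ) / u
      = u ^ (2 * p) / ((2 * p).factorial : ℝ) * (1 / (2 * p + 1 : ℝ)) := by
        rw [Nat.factorial_succ]
        push_cast
        field_simp
        ring
    _ ≤ _ := by gcongr

theorem exp_div_le_expCosMean {d : ℕ} (hd : 1 ≤ d) {u : ℝ} (hu : 1 ≤ u) :
    Real.exp u / (4 * u) ≤ expCosMean (2 * d) u := by
  have hu0 : 0 < u := by linarith
  refine le_trans ?_ (sinh_div_le_expCosMean hd hu0)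
  have h1 : Real.exp (-u) ≤ 1 := Real.exp_le_one_iff.2 (by linarith)
  have h2 : u + 1 ≤ Real.exp u := Real.add_one_le_exp u
  rw [Real.sinh_eq, div_div, div_le_div_iff₀ (by positivity) (by positivity)]
  nlinarith

theorem alphad_nonneg {d : ℕ} (hd : 1 ≤ d) (u : ℝ) : 0 ≤ alphad (2 * d) u :=
  Real.log_nonneg (one_le_expCosMean hd u)

theorem alphad_le_half_sq {d : ℕ} (hd : 1 ≤ d) (u : ℝ) : alphad (2 * d) u ≤ u ^ 2 / 2 :=
  (Real.log_le_iff_le_exp (expCosMean_pos (by omega) u)).2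
    ((expCosMean_le_cosh hd u).trans (Real.cosh_le_exp_half_sq u))

theorem alphad_le_self {d : ℕ} (hd : 1 ≤ d) {u : ℝ} (hu : 0 ≤ u) : alphad (2 * d) u ≤ u := by
  refine (Real.log_le_iff_le_exp (expCosMean_pos (by omega) u)).2
    ((expCosMean_le_cosh hd u).trans ?_)
  have := Real.exp_le_exp.2 (show -u ≤ u by linarith)
  rw [Real.cosh_eq]
  linarith

theorem self_sub_alphad_le {d : ℕ} (hd : 1 ≤ d) {u : ℝ} (hu : 1 ≤ u) :
    u - alphad (2 * d) u ≤ 4 * √u := by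
  have hu0 : 0 < u := by linarith
  have h := Real.log_le_log (by positivity) (exp_div_le_expCosMean hd hu)
  rw [Real.log_div (Real.exp_ne_zero _) (by positivity), Real.log_exp, ← alphad_eq_log] at h
  have h4 : Real.log (4 * u) ≤ 4 * √u := by
    have e : 4 * u = (2 * √u) ^ 2 := by rw [mul_pow, Real.sq_sqrt hu0.le]; norm_num
    rw [e, Real.log_pow]
    have := Real.log_le_self (show 0 ≤ 2 * √u by positivity)
    push_cast
    linarith
  linarith

theorem alphad_succ_lt {d : ℕ} (hd : 1 ≤ d) {u : ℝ} (hu : u ≠ 0) :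
    alphad (2 * (d + 1)) u < alphad (2 * d) u :=
  Real.log_lt_log (expCosMean_pos (by omega) u) (expCosMean_succ_lt hd hu)

theorem norm_alphad_div_sq_le {d : ℕ} (hd : 1 ≤ d) (u : ℝ) :
    ‖alphad (2 * d) u / u ^ 2‖ ≤ 1 / 2 := by
  rw [Real.norm_of_nonneg (div_nonneg (alphad_nonneg hd u) (sq_nonneg u))]
  refine div_le_of_le_mul₀ (sq_nonneg u) (by norm_num) ?_
  linarith [alphad_le_half_sq hd u]

theorem norm_alphad_sub_div_sq_le {d : ℕ} (hd : 1 ≤ d) {u : ℝ} (hu : 1 ≤ u) :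
    ‖(alphad (2 * d) u - u) / u ^ 2‖ ≤ 4 * u ^ (-(3 / 2) : ℝ) := by
  have hu0 : 0 < u := by linarith
  have e : 4 * u ^ (-(3 / 2) : ℝ) = 4 * √u / u ^ 2 := by
    rw [Real.sqrt_eq_rpow, mul_div_assoc, ← Real.rpow_natCast u 2, ← Real.rpow_sub hu0]
    norm_num
  rw [e, norm_div, Real.norm_of_nonneg (sq_nonneg u), Real.norm_eq_abs, abs_sub_comm,
    abs_of_nonneg (by linarith [alphad_le_self hd hu0.le])]
  gcongr
  exact self_sub_alphad_le hd hu

theorem aestronglyMeasurable_alphad_div_sq {d : ℕ} (hd : 1 ≤ d) (μ : MeasureTheory.Measure ℝ) :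
    MeasureTheory.AEStronglyMeasurable (fun u => alphad (2 * d) u / u ^ 2) μ :=
  ((continuous_alphad (by omega)).measurable.div (by fun_prop)).aestronglyMeasurable

theorem aestronglyMeasurable_alphad_sub_div_sq {d : ℕ} (hd : 1 ≤ d)
    (μ : MeasureTheory.Measure ℝ) :
    MeasureTheory.AEStronglyMeasurable (fun u => (alphad (2 * d) u - u) / u ^ 2) μ :=
  (((continuous_alphad (by omega)).measurable.sub measurable_id).div
    (by fun_prop)).aestronglyMeasurable

theorem intervalIntegrable_alphad_div_sq {d : ℕ} (hd : 1 ≤ d) :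
    IntervalIntegrable (fun u => alphad (2 * d) u / u ^ 2) MeasureTheory.volume 0 1 :=
  (intervalIntegrable_const (c := (1 / 2 : ℝ))).mono_fun'
    (aestronglyMeasurable_alphad_div_sq hd _)
    (Filter.Eventually.of_forall fun u => norm_alphad_div_sq_le hd u)

theorem integrableOn_rpow_bound :
    MeasureTheory.IntegrableOn (fun u : ℝ => 4 * u ^ (-(3 / 2) : ℝ)) (Set.Ioi 1) :=
  (integrableOn_Ioi_rpow_of_lt (by norm_num) one_pos).const_mul 4

theorem ae_norm_alphad_sub_div_sq_le {d : ℕ} (hd : 1 ≤ d) :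
    ∀ᵐ u ∂(MeasureTheory.volume.restrict (Set.Ioi (1 : ℝ))),
      ‖(alphad (2 * d) u - u) / u ^ 2‖ ≤ 4 * u ^ (-(3 / 2) : ℝ) :=
  (MeasureTheory.ae_restrict_mem measurableSet_Ioi).mono fun _ hu =>
    norm_alphad_sub_div_sq_le hd (le_of_lt hu)

theorem integrableOn_alphad_sub_div_sq {d : ℕ} (hd : 1 ≤ d) :
    MeasureTheory.IntegrableOn (fun u => (alphad (2 * d) u - u) / u ^ 2) (Set.Ioi 1) :=
  MeasureTheory.Integrable.mono' integrableOn_rpow_bound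
    (aestronglyMeasurable_alphad_sub_div_sq hd _) (ae_norm_alphad_sub_div_sq_le hd)

theorem Cconst_succ_lt {d : ℕ} (hd : 1 ≤ d) : Cconst (2 * (d + 1)) < Cconst (2 * d) := by
  have hd' : 1 ≤ d + 1 := by omega
  have h1 : ∫ u in Set.Ioi (1 : ℝ), (alphad (2 * (d + 1)) u - u) / u ^ 2 ≤
      ∫ u in Set.Ioi (1 : ℝ), (alphad (2 * d) u - u) / u ^ 2 := by
    refine MeasureTheory.setIntegral_mono_on (integrableOn_alphad_sub_div_sq hd')
      (integrableOn_alphad_sub_div_sq hd) measurableSet_Ioi fun u hu => ?_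
    have := alphad_succ_lt hd (zero_lt_one.trans hu).ne'
    gcongr
  have h2 : ∫ u in (0 : ℝ)..1, alphad (2 * (d + 1)) u / u ^ 2 <
      ∫ u in (0 : ℝ)..1, alphad (2 * d) u / u ^ 2 := by
    rw [← sub_pos, ← intervalIntegral.integral_sub (intervalIntegrable_alphad_div_sq hd)
      (intervalIntegrable_alphad_div_sq hd')]
    refine intervalIntegral.intervalIntegral_pos_of_pos_on
      ((intervalIntegrable_alphad_div_sq hd).sub (intervalIntegrable_alphad_div_sq hd'))
      (fun u hu => ?_) one_pos
    have := hu.1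
    rw [sub_pos]
    exact div_lt_div_of_pos_right (alphad_succ_lt hd hu.1.ne') (by positivity)
  have hpi : 0 < 2 / Real.pi := by positivity
  unfold Cconst
  refine add_lt_add_of_le_of_lt ?_ (mul_lt_mul_of_pos_left h2 hpi)
  gcongr

theorem I0_eq_tsum (u : ℝ) :
    I0 u = ∑' p : ℕ, u ^ (2 * p) / (2 * p).factorial * ((2 * p).choose p / 4 ^ p : ℝ) := by
  refine tsum_congr fun p => ?_
  have h : ((2 * p).choose p : ℝ) * p.factorial * p.factorial = (2 * p).factorial := by
    have := Nat.choose_mul_factorial_mul_factorial (show p ≤ 2 * p by omega)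
    rw [show 2 * p - p = p by omega] at this
    exact_mod_cast this
  have hc : ((2 * p).choose p : ℝ) ≠ 0 := by
    exact_mod_cast (Nat.choose_pos (by omega)).ne'
  rw [← h, div_pow, pow_mul 2, show (2 : ℝ) ^ 2 = 4 by norm_num]
  field_simp

theorem tendsto_expCosMean (u : ℝ) :
    Filter.Tendsto (fun d : ℕ => expCosMean (2 * d) u) Filter.atTop (nhds (I0 u)) := by
  rw [I0_eq_tsum]
  have h := tendsto_tsum_of_dominated_convergence (𝓕 := Filter.atTop)
    (f := fun d p : ℕ => u ^ (2 * p) / (2 * p).factorial * (chooseSum d p / 4 ^ p : ℝ))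
    (g := fun p => u ^ (2 * p) / (2 * p).factorial * ((2 * p).choose p / 4 ^ p : ℝ))
    (Real.hasSum_cosh u).summable
    (fun p => tendsto_const_nhds.congr' ((Filter.eventually_gt_atTop p).mono fun d hd => by
      simp only [chooseSum_of_lt hd]))
    (Filter.Eventually.of_forall fun d p => by
      have h : (chooseSum d p : ℝ) ≤ 4 ^ p := by exact_mod_cast chooseSum_le_four_pow d p
      have h0 : 0 ≤ u ^ (2 * p) := (even_two_mul p).pow_nonneg u
      rw [Real.norm_of_nonneg (by positivity)]
      exact mul_le_of_le_one_right (by positivity) (div_le_one_of_le₀ h (by positivity)))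
  refine h.congr' ((Filter.eventually_ge_atTop 1).mono fun d hd => ?_)
  exact (hasSum_expCosMean hd u).tsum_eq

theorem tendsto_alphad (u : ℝ) :
    Filter.Tendsto (fun d : ℕ => alphad (2 * d) u) Filter.atTop (nhds (Real.log (I0 u))) := by
  refine (tendsto_expCosMean u).log (ne_of_gt (zero_lt_one.trans_le ?_))
  exact ge_of_tendsto (tendsto_expCosMean u)
    ((Filter.eventually_ge_atTop 1).mono fun d hd => one_le_expCosMean hd u)

theorem tendsto_integral_alphad_div_sq :
    Filter.Tendsto (fun d : ℕ => ∫ u in (0 : ℝ)..1, alphad (2 * d) u / u ^ 2) Filter.atTop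
      (nhds (∫ u in (0 : ℝ)..1, Real.log (I0 u) / u ^ 2)) := by
  refine intervalIntegral.tendsto_integral_filter_of_dominated_convergence (fun _ => 1 / 2)
    ?_ ?_ intervalIntegrable_const ?_
  · exact (Filter.eventually_ge_atTop 1).mono fun d hd => aestronglyMeasurable_alphad_div_sq hd _
  · exact (Filter.eventually_ge_atTop 1).mono fun d hd =>
      Filter.Eventually.of_forall fun u _ => norm_alphad_div_sq_le hd u
  · exact Filter.Eventually.of_forall fun u _ => (tendsto_alphad u).div_const _

theorem tendsto_integral_alphad_sub_div_sq :
    Filter.Tendsto (fun d : ℕ => ∫ u in Set.Ioi (1 : ℝ), (alphad (2 * d) u - u) / u ^ 2)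
      Filter.atTop (nhds (∫ u in Set.Ioi (1 : ℝ), (Real.log (I0 u) - u) / u ^ 2)) := by
  refine MeasureTheory.tendsto_integral_filter_of_dominated_convergence _
    ?_ ?_ integrableOn_rpow_bound ?_
  · exact (Filter.eventually_ge_atTop 1).mono fun d hd =>
      aestronglyMeasurable_alphad_sub_div_sq hd _
  · exact (Filter.eventually_ge_atTop 1).mono fun d hd => ae_norm_alphad_sub_div_sq_le hd
  · exact Filter.Eventually.of_forall fun u => ((tendsto_alphad u).sub_const u).div_const _

theorem intervalIntegrable_log_I0_div_sq :
    IntervalIntegrable (fun u => Real.log (I0 u) / u ^ 2) MeasureTheory.volume 0 1 := by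
  have hlim : ∀ u : ℝ, Filter.Tendsto (fun d : ℕ => alphad (2 * (d + 1)) u / u ^ 2) Filter.atTop
      (nhds (Real.log (I0 u) / u ^ 2)) := fun u =>
    ((tendsto_alphad u).div_const _).comp (Filter.tendsto_add_atTop_nat 1)
  refine (intervalIntegrable_const (c := (1 / 2 : ℝ))).mono_fun'
    (aestronglyMeasurable_of_tendsto_ae Filter.atTop
      (fun d : ℕ => aestronglyMeasurable_alphad_div_sq (d := d + 1) (by omega) _)
      (Filter.Eventually.of_forall hlim))
    (Filter.Eventually.of_forall fun u => ?_)
  exact le_of_tendsto (hlim u).norm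
    (Filter.Eventually.of_forall fun d => norm_alphad_div_sq_le (by omega) u)

/-- Lemma 5.9: the sequence `(C_{2d})_{d≥1}` is decreasing, and its limit as `d → ∞`
is `(2/π)(γ + log(4/π) + ∫₀¹ log I₀(u)/u² du + ∫₁^∞ (log I₀(u) − u)/u² du)`. -/
theorem Cconst_decreasing_and_limit :
    (∀ d : ℕ, 1 ≤ d → Cconst (2 * (d + 1)) < Cconst (2 * d)) ∧
    Filter.Tendsto (fun d : ℕ => Cconst (2 * d)) Filter.atTop
      (nhds (2 / Real.pi * (Real.eulerMascheroniConstant + Real.log (4 / Real.pi)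
        + ∫ u in (0:ℝ)..1, Real.log (I0 u) / u ^ 2
        + ∫ u in Set.Ioi (1:ℝ), (Real.log (I0 u) - u) / u ^ 2))) := by
  refine ⟨fun d hd => Cconst_succ_lt hd, ?_⟩
  rw [intervalIntegral.integral_add intervalIntegrable_log_I0_div_sq intervalIntegrable_const,
    intervalIntegral.integral_const, sub_zero, one_smul]
  convert ((tendsto_integral_alphad_sub_div_sq.const_add
    (Real.eulerMascheroniConstant + Real.log (4 / Real.pi))).const_mul (2 / Real.pi)).add
    (tendsto_integral_alphad_div_sq.const_mul (2 / Real.pi)) using 2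
  · rfl
  · ring

end
end

section
/- Let p be a prime and χ a Dirichlet character (mod p) of order d. Uniformly for all integers n ≤ p, all pairwise distinct m₁, …, m_n ∈ F_p and all tuples (a₁, …, a_n) ∈ U_d^n: (1/p)·#{ K ∈ F_p : χ(K + m_j) = a_j for all 1 ≤ j ≤ n } = 1/dⁿ + O(n/√p), with an absolute implied constant. -/
open scoped BigOperators Classical

noncomputable section

/-- `U_d`: the set of `d`-th roots of unity `{e^{2πik/d} : 0 ≤ k < d}`. -/
def Ud (d : ℕ) : Set ℂ :=
  {z | ∃ k < d, z = Complex.exp (2 * Real.pi * Complex.I * k / d)}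

open Polynomial in
theorem X_pow_sub_C_irreducible_of_forall_prime {K : Type*} [Field K] {n : ℕ} (hn : n ≠ 0) {a : K}
    (ha : ∀ p : ℕ, p.Prime → p ∣ n → ∀ b : K, b ^ p ≠ a ∧ b ^ p ≠ -a) :
    Irreducible (X ^ n - C a : K[X]) := by
  induction n using induction_on_primes generalizing K a with
  | zero => exact absurd rfl hn
  | one => simpa using irreducible_X_sub_C a
  | prime_mul p n hp IH =>
    rw [mul_comm]
    apply X_pow_mul_sub_C_irreducible
      (X_pow_sub_C_irreducible_of_prime hp fun b => (ha p hp (dvd_mul_right _ _) b).1)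
    intro E _ _ x hx
    have hxK : IsIntegral K x := not_not.mp fun h ↦ by
      simpa only [degree_zero, degree_X_pow_sub_C hp.pos,
        WithBot.natCast_ne_bot] using congr_arg degree (hx.symm.trans (dif_neg h))
    have hnorm : Algebra.norm K (IntermediateField.AdjoinSimple.gen K x) = (-1) ^ p * -a := by
      rw [← IntermediateField.adjoin.powerBasis_gen hxK,
        Algebra.PowerBasis.norm_gen_eq_coeff_zero_minpoly]
      simp [IntermediateField.minpoly_gen, hx, hp.ne_zero.symm]
    have key : ∀ q : ℕ, q.Prime → q ∣ n → ∀ c : K, c ^ q ≠ (-1) ^ p * -a ∧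
        c ^ q ≠ (-1) ^ q * ((-1) ^ p * -a) := by
      intro q hq hqn c
      have h := ha q hq (dvd_mul_of_dvd_right hqn p) c
      rcases neg_one_pow_eq_or K p with h1 | h1 <;> rcases neg_one_pow_eq_or K q with h2 | h2 <;>
        simp [h1, h2, h.1, h.2]
    apply IH (by rintro rfl; simp at hn)
    intro q hq hqn b
    constructor
    · intro hb
      apply (key q hq hqn (Algebra.norm _ b)).1
      rw [← map_pow, hb, hnorm]
    · intro hb
      have hn2 : Algebra.norm K b ^ q
          = Algebra.norm K (-1 : IntermediateField.adjoin K {x}) * ((-1) ^ p * -a) := by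
        rw [← map_pow, hb, ← hnorm, ← map_mul]; simp
      have h1 : Algebra.norm K (-1 : IntermediateField.adjoin K {x}) = (-1) ^ p := by
        have : (-1 : IntermediateField.adjoin K {x})
          = algebraMap K (IntermediateField.adjoin K {x}) (-1) := by simp
        rw [this, Algebra.norm_algebraMap, IntermediateField.adjoin.finrank hxK, hx,
          natDegree_X_pow_sub_C]
      rw [h1] at hn2
      rcases neg_one_pow_eq_or K p with h | h
      · exact (key q hq hqn (Algebra.norm _ b)).1 (by rw [hn2, h]; ring)
      · have := ha q hq (dvd_mul_of_dvd_right hqn p) (Algebra.norm _ b)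
        rw [hn2, h] at this
        simp at this

open Polynomial in
theorem natDegree_det_le {R ι : Type*} [CommRing R] [Fintype ι] [DecidableEq ι]
    (M : Matrix ι ι R[X]) (b : ℕ) (hM : ∀ i j, (M i j).natDegree ≤ b) :
    M.det.natDegree ≤ Fintype.card ι * b := by
  rw [Matrix.det_apply]
  refine natDegree_sum_le_of_forall_le _ _ fun g _ => ?_
  have h : (∏ i, M (g i) i).natDegree ≤ Fintype.card ι * b :=
    (natDegree_prod_le _ _).trans <| (Finset.sum_le_card_nsmul _ _ b fun i _ => hM _ _).trans
      (by simp [Finset.card_univ])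
  rcases Int.units_eq_one_or (Equiv.Perm.sign g) with sg | sg <;> simpa [sg, Units.neg_smul] using h

open Polynomial in
theorem natDegree_resultant_le {R : Type*} [CommRing R] (f g : R[X][X]) (m n b : ℕ)
    (hf : ∀ i, (f.coeff i).natDegree ≤ b) (hg : ∀ i, (g.coeff i).natDegree ≤ b) :
    (resultant f g m n).natDegree ≤ (m + n) * b := by
  refine (natDegree_det_le _ b fun i j => ?_).trans (by simp)
  unfold sylvester
  refine Fin.addCases (fun j => ?_) (fun j => ?_) j <;> simp only [Matrix.of_apply,
    Fin.addCases_left, Fin.addCases_right] <;> split_ifs <;> simp [hf, hg]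

open Polynomial in
/-- Polynomials of small degree stay independent over the powers of a root of `Y ^ d = h`
modulo a high power of `X`. -/
theorem coeff_eq_zero_of_X_pow_dvd {F : Type*} [Field F] {d m A Q : ℕ} (hd : d ≠ 0) {h y : F[X]}
    (hirr : Irreducible (X ^ d - C (algebraMap F[X] (RatFunc F) h)))
    (hy : X ^ Q ∣ y ^ d - h) (hm : h.natDegree ≤ m) (hQ : 2 * d * (A + m) < Q)
    (a : Fin d → F[X]) (ha : ∀ i, (a i).natDegree ≤ A)
    (hdvd : X ^ Q ∣ ∑ i, a i * y ^ (i : ℕ)) : ∀ i, a i = 0 := by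
  set z : F[X][X] := ∑ i : Fin d, C (a i) * X ^ (i : ℕ) with hz
  have hcoeff : ∀ k, z.coeff k = if hk : k < d then a ⟨k, hk⟩ else 0 := by
    intro k
    simp only [hz, finsetSum_coeff, coeff_C_mul, coeff_X_pow]
    split_ifs with hk
    · rw [Finset.sum_eq_single ⟨k, hk⟩] <;> simp +contextual [Fin.ext_iff]
      exact fun b hb h => absurd h.symm hb
    · exact Finset.sum_eq_zero fun i _ => by
        have := i.2
        simp [show k ≠ i by omega]
  have hzdeg : z.degree < d := by
    rw [degree_lt_iff_coeff_zero]
    intro k hk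
    simp [hcoeff, not_lt.2 hk]
  suffices hz0 : z = 0 by
    intro i
    have := hcoeff i
    simpa [hz0] using this.symm
  by_contra hz0
  set g : F[X][X] := X ^ d - C h with hg
  have hgnat : g.natDegree = d := natDegree_X_pow_sub_C
  have hznat : z.natDegree < d := (natDegree_lt_iff_degree_lt hz0).2 hzdeg
  have hinj : Function.Injective (algebraMap F[X] (RatFunc F)) :=
    IsFractionRing.injective _ _
  have hres : resultant z g ≠ 0 := by
    intro h0
    have h1 := congrArg (algebraMap F[X] (RatFunc F)) h0
    rw [map_zero, ← resultant_map_map] at h1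
    rw [← natDegree_map_eq_of_injective hinj z, ← natDegree_map_eq_of_injective hinj g,
      resultant_eq_zero_iff] at h1
    apply h1.2
    have hgm : g.map (algebraMap F[X] (RatFunc F))
        = X ^ d - C (algebraMap F[X] (RatFunc F) h) := by simp [hg]
    rw [hgm]
    refine IsCoprime.symm ((hirr.coprime_iff_not_dvd).2 fun hdv => ?_)
    have hle := degree_le_of_dvd hdv (by rwa [Ne, Polynomial.map_eq_zero_iff hinj])
    rw [degree_X_pow_sub_C (Nat.pos_of_ne_zero hd), degree_map_eq_of_injective hinj] at hle
    exact absurd hzdeg (not_lt.2 hle)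
  obtain ⟨u, v, -, -, huv⟩ := exists_mul_add_mul_eq_C_resultant z g le_rfl le_rfl
    (Or.inr (by rwa [hgnat]))
  have hev := congrArg (eval y) huv
  have hzev : z.eval y = ∑ i, a i * y ^ (i : ℕ) := by
    simp [hz, eval_finsetSum]
  have hgev : g.eval y = y ^ d - h := by simp [hg]
  rw [eval_add, eval_mul, eval_mul, eval_C, hzev, hgev] at hev
  have hdv : X ^ Q ∣ resultant z g := hev ▸ dvd_add (hdvd.mul_right _) (hy.mul_right _)
  have hle := natDegree_le_of_dvd hdv hres
  rw [natDegree_X_pow] at hle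
  have hub := natDegree_resultant_le z g z.natDegree g.natDegree (A + m) (fun i => by
    rw [hcoeff]; split_ifs
    · exact (ha _).trans (Nat.le_add_right _ _)
    · simp) (fun i => by
    rw [hg, coeff_sub, coeff_X_pow, coeff_C]
    refine (natDegree_sub_le _ _).trans (max_le ?_ ?_)
    · split_ifs <;> simp
    · split_ifs
      · omega
      · simp)
  have : (z.natDegree + g.natDegree) * (A + m) ≤ 2 * d * (A + m) :=
    Nat.mul_le_mul_right _ (by omega)
  omega

open Polynomial in
theorem eq_zero_of_sum_X_pow_mul_eq_zero {F : Type*} [Field F] {d m A Q : ℕ} (hd : d ≠ 0)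
    {h y : F[X]} (hirr : Irreducible (X ^ d - C (algebraMap F[X] (RatFunc F) h)))
    (hy : X ^ Q ∣ y ^ d - h) (hm : h.natDegree ≤ m) (hQ : 2 * d * (A + m) < Q) (J : ℕ)
    (a : ℕ → Fin d → F[X]) (ha : ∀ j i, (a j i).natDegree ≤ A)
    (hsum : ∑ j ∈ Finset.range J, X ^ (j * Q) * ∑ i, a j i * y ^ (i : ℕ) = 0) :
    ∀ j < J, ∀ i, a j i = 0 := by
  induction J generalizing a with
  | zero => simp
  | succ J ih =>
    rw [Finset.sum_range_succ'] at hsum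
    have hfac : ∑ j ∈ Finset.range J, X ^ ((j + 1) * Q) * ∑ i, a (j + 1) i * y ^ (i : ℕ)
        = X ^ Q * ∑ j ∈ Finset.range J, X ^ (j * Q) * ∑ i, a (j + 1) i * y ^ (i : ℕ) := by
      rw [Finset.mul_sum]
      exact Finset.sum_congr rfl fun j _ => by ring
    rw [hfac, zero_mul, pow_zero, one_mul] at hsum
    have h0 := coeff_eq_zero_of_X_pow_dvd hd hirr hy hm hQ (a 0) (ha 0)
      ((dvd_add_right (dvd_mul_right _ _)).1 (hsum ▸ dvd_zero _))
    have hrest := ih (fun j => a (j + 1)) (fun j => ha (j + 1)) (by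
      simp only [h0, zero_mul, Finset.sum_const_zero, add_zero, mul_eq_zero] at hsum
      exact hsum.resolve_left (pow_ne_zero _ X_ne_zero))
    rintro (_ | j) hj i
    · exact h0 i
    · exact hrest j (by omega) i

open Polynomial in
/-- Stepanov's bound for the number of `x` at which `f x ^ ((Q ^ 2 - 1) / d)` takes a given value,
where `e = (Q - 1) / d`. -/
theorem card_pow_eval_eq_le {F : Type*} [Field F] [Fintype F] {p s d e m A J Q : ℕ} [Fact p.Prime]
    [CharP F p] (hQ : Q = p ^ s) (hcard : Fintype.card F = Q ^ 2) (hd : d ≠ 0) (he : Q = d * e + 1)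
    {f : F[X]} (hf0 : f.coeff 0 ≠ 0) (hm : f.natDegree ≤ m)
    (hirr : ∀ κ : F, κ ≠ 0 →
      Irreducible (X ^ d - C (algebraMap F[X] (RatFunc F) (C κ * f))))
    {α : F} (hα : α ≠ 0) (hA : 2 * d * (A + m) < Q)
    (hcount : A * Q + J + m * (d + Q) < A * J * d) :
    (Finset.univ.filter fun x : F => f.eval x ^ (e * (Q + 1)) = α).card
      ≤ A + J * Q + d * m * Q := by
  have hAQ : A ≤ Q := by nlinarith [Nat.pos_of_ne_zero hd]
  set v : F[X] := f ^ (1 + e) with hv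
  set y : F[X] := f ^ (1 + (d - 1) * e) with hy
  let S := Fin A × Fin J × Fin d
  set T := A * Q + J + m * (d + Q) with hT
  let G : (S → F) →ₗ[F] F[X] :=
    ∑ t : S, (LinearMap.toSpanSingleton F F[X]
      (C (α⁻¹ ^ (t.2.2 : ℕ)) * X ^ (t.1 * Q + t.2.1 : ℕ) * v ^ (t.2.2 : ℕ))).comp
        (LinearMap.proj t)
  have hG : ∀ c, G c = ∑ t : S, C (c t) *
      (C (α⁻¹ ^ (t.2.2 : ℕ)) * X ^ (t.1 * Q + t.2.1 : ℕ) * v ^ (t.2.2 : ℕ)) := by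
    intro c
    simp [G, LinearMap.sum_apply, smul_eq_C_mul]
  have hGdeg : ∀ c, (G c).natDegree < T := by
    intro c
    by_cases hS : Nonempty S
    swap
    · exfalso
      have : Fintype.card S = 0 := Fintype.card_eq_zero_iff.2 (not_nonempty_iff.1 hS)
      simp only [S, Fintype.card_prod, Fintype.card_fin] at this
      rw [← mul_assoc] at this
      omega
    have hT0 : 0 < T := by
      obtain ⟨t⟩ := hS
      have := t.2.1.2
      omega
    rw [hG]
    refine Nat.lt_of_le_pred hT0 (natDegree_sum_le_of_forall_le _ _ fun t _ => ?_)
    refine (natDegree_C_mul_le _ _).trans (natDegree_mul_le.trans ?_)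
    have h1 : (C (α⁻¹ ^ (t.2.2 : ℕ)) * X ^ (t.1 * Q + t.2.1 : ℕ) : F[X]).natDegree
      ≤ t.1 * Q + t.2.1 := natDegree_C_mul_X_pow_le _ _
    have h2 : (v ^ (t.2.2 : ℕ)).natDegree ≤ m * (d + Q) := by
      rw [hv, ← pow_mul]
      refine natDegree_pow_le.trans ?_
      rw [mul_comm]
      refine Nat.mul_le_mul hm ?_
      have := t.2.2.2
      calc (1 + e) * (t.2.2 : ℕ) ≤ (1 + e) * d := Nat.mul_le_mul_left _ this.le
        _ ≤ d + Q := by rw [he]; nlinarith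
    have h3 : (t.1 : ℕ) * Q + t.2.1 + 1 ≤ A * Q + J := by
      have h4 : (t.1 : ℕ) * Q ≤ A * Q := Nat.mul_le_mul_right _ t.1.2.le
      have := t.2.1.2
      omega
    rw [Nat.pred_eq_sub_one]
    omega
  obtain ⟨c, hcG, hc0⟩ : ∃ c, G c = 0 ∧ c ≠ 0 := by
    let L : (S → F) →ₗ[F] (Fin T → F) := LinearMap.pi fun k => (lcoeff F k).comp G
    have hker : LinearMap.ker L ≠ ⊥ := by
      apply LinearMap.ker_ne_bot_of_finrank_lt
      simp only [Module.finrank_fintype_fun_eq_card, S, Fintype.card_prod, Fintype.card_fin]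
      rw [← mul_assoc]
      exact hcount
    obtain ⟨c, hc, hc0⟩ := Submodule.exists_mem_ne_zero_of_ne_bot hker
    refine ⟨c, ?_, hc0⟩
    ext k
    by_cases hk : k < T
    · exact congrFun hc ⟨k, hk⟩
    · rw [coeff_eq_zero_of_natDegree_lt ((hGdeg c).trans_le (not_lt.1 hk)), coeff_zero]
  set H : F[X] := ∑ t : S, C (c t ^ Q) * X ^ (t.1 + t.2.1 * Q : ℕ) * y ^ (t.2.2 : ℕ) with hH
  have hQ0 : 0 < Q := by omega
  have hHdeg : H.natDegree ≤ A + J * Q + d * m * Q := by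
    refine natDegree_sum_le_of_forall_le _ _ fun t _ => natDegree_mul_le.trans ?_
    have h1 : (C (c t ^ Q) * X ^ (t.1 + t.2.1 * Q : ℕ) : F[X]).natDegree
      ≤ t.1 + t.2.1 * Q := natDegree_C_mul_X_pow_le _ _
    have h2 : (t.1 : ℕ) + t.2.1 * Q ≤ A + J * Q :=
      Nat.add_le_add t.1.2.le (Nat.mul_le_mul_right _ t.2.1.2.le)
    have h3 : (y ^ (t.2.2 : ℕ)).natDegree ≤ d * m * Q := by
      rw [hy, ← pow_mul]
      refine natDegree_pow_le.trans ?_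
      have h4 : 1 + (d - 1) * e ≤ Q := by
        have : (d - 1) * e ≤ d * e := Nat.mul_le_mul_right _ (Nat.sub_le _ _)
        omega
      calc (1 + (d - 1) * e) * (t.2.2 : ℕ) * f.natDegree ≤ Q * d * m :=
            Nat.mul_le_mul (Nat.mul_le_mul h4 t.2.2.2.le) hm
        _ = d * m * Q := by ring
    omega
  have hH0 : H ≠ 0 := by
    intro hzero
    set κ : F := (f.coeff 0) ^ (Q * (d - 1)) with hκ
    have hκ0 : κ ≠ 0 := pow_ne_zero _ hf0
    have hyd : X ^ Q ∣ y ^ d - C κ * f := by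
      have h1 : y ^ d = (f ^ Q) ^ (d - 1) * f := by
        rw [hy, ← pow_mul, ← pow_mul, ← pow_succ]
        congr 1
        obtain ⟨k, rfl⟩ := Nat.exists_eq_succ_of_ne_zero hd
        rw [he]; simp only [Nat.succ_eq_add_one, Nat.add_sub_cancel]; ring
      have h2 : C κ = ((C (f.coeff 0)) ^ Q) ^ (d - 1) := by
        rw [hκ, pow_mul, C_pow, C_pow]
      rw [h1, h2, ← sub_mul]
      refine Dvd.dvd.mul_right ((?_ : X ^ Q ∣ f ^ Q - C (f.coeff 0) ^ Q).trans
        (sub_dvd_pow_sub_pow _ _ _)) _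
      rw [hQ, ← sub_pow_char_pow]
      exact pow_dvd_pow_of_dvd (X_dvd_iff.2 (by simp)) _
    let a : ℕ → Fin d → F[X] := fun j i =>
      if hj : j < J then ∑ k : Fin A, C (c (k, ⟨j, hj⟩, i) ^ Q) * X ^ (k : ℕ) else 0
    have ha : ∀ j i, (a j i).natDegree ≤ A := by
      intro j i
      simp only [a]
      split_ifs
      · exact natDegree_sum_le_of_forall_le _ _ fun k _ =>
          (natDegree_C_mul_X_pow_le _ _).trans k.2.le
      · simp
    have hsum : ∑ j ∈ Finset.range J, X ^ (j * Q) * ∑ i, a j i * y ^ (i : ℕ) = 0 := by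
      rw [← hzero, hH, Fintype.sum_prod_type_right, Fintype.sum_prod_type,
        Finset.sum_range]
      refine Finset.sum_congr rfl fun j _ => ?_
      rw [Finset.mul_sum]
      refine Finset.sum_congr rfl fun i _ => ?_
      simp only [a, j.2, dif_pos, Finset.sum_mul, Finset.mul_sum]
      exact Finset.sum_congr rfl fun k _ => by ring
    have hall := eq_zero_of_sum_X_pow_mul_eq_zero hd (hirr κ hκ0) hyd
      ((natDegree_C_mul_le _ _).trans hm) hA J a ha hsum
    apply hc0
    funext ⟨k, j, i⟩
    have h1 := congrArg (fun P => coeff P (k : ℕ)) (hall j j.2 i)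
    simp only [a, j.2, dif_pos, finsetSum_coeff, coeff_C_mul, coeff_X_pow, coeff_zero] at h1
    rw [Finset.sum_eq_single k (fun b _ hb => by
      simp [show (k : ℕ) ≠ b from fun h => hb (Fin.ext h.symm)]) (by simp)] at h1
    simpa [hQ0.ne'] using h1
  have hfrob : ∀ x : F, x ^ (Q * Q) = x := fun x => by
    rw [← sq, ← hcard]; exact FiniteField.pow_card x
  have hroot : ∀ x : F, f.eval x ^ (e * (Q + 1)) = α → H.eval x = 0 := by
    intro x hx
    have hyx : y.eval x ^ Q = α⁻¹ * v.eval x := by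
      rw [eq_inv_mul_iff_mul_eq₀ hα, ← hx, hy, hv, eval_pow, eval_pow, ← pow_mul, ← pow_add,
        pow_add _ 1 e, pow_one]
      conv_rhs => rw [← hfrob (f.eval x)]
      rw [pow_right_comm, hfrob, hfrob, ← pow_succ']
      have : e * (Q + 1) + (1 + (d - 1) * e) * Q = Q * Q + e := by
        obtain ⟨k, rfl⟩ := Nat.exists_eq_succ_of_ne_zero hd
        rw [he]; simp only [Nat.succ_eq_add_one, Nat.add_sub_cancel]; ring
      rw [this, pow_add, hfrob, ← pow_succ']
    have hpow : H.eval x ^ Q = (G c).eval x := by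
      rw [hH, hG, eval_finsetSum, eval_finsetSum]
      conv_lhs => rw [hQ, sum_pow_char_pow, ← hQ]
      refine Finset.sum_congr rfl fun t _ => ?_
      simp only [eval_mul, eval_C, eval_pow, eval_X]
      have h1 : (c t ^ Q) ^ Q = c t := by rw [← pow_mul, hfrob]
      have h2 : (x ^ ((t.1 : ℕ) + t.2.1 * Q)) ^ Q = x ^ ((t.1 : ℕ) * Q + t.2.1) := by
        rw [← pow_mul, add_mul, pow_add, pow_add, mul_assoc, mul_comm (t.2.1 : ℕ), pow_mul x (Q * Q),
          hfrob]
      have h3 : (y.eval x ^ (t.2.2 : ℕ)) ^ Q = α⁻¹ ^ (t.2.2 : ℕ) * v.eval x ^ (t.2.2 : ℕ) := by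
        rw [pow_right_comm, hyx, mul_pow]
      rw [mul_pow, mul_pow, h1, h2, h3]
      ring
    rw [hcG, eval_zero] at hpow
    exact pow_eq_zero_iff hQ0.ne' |>.1 hpow
  refine le_trans ?_ hHdeg
  refine le_trans (Finset.card_le_card (t := H.roots.toFinset) fun x hx => ?_)
    ((Multiset.toFinset_card_le _).trans (card_roots' H))
  rw [Multiset.mem_toFinset, mem_roots hH0]
  exact hroot x (Finset.mem_filter.1 hx).2

open Polynomial in
/-- With explicit parameters, Stepanov's bound reads `Q ^ 2 / d + O(Q)`. -/
theorem card_pow_eval_eq_le_of_large (d m : ℕ) (hd : d ≠ 0) : ∃ B Q₀ : ℕ,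
    ∀ {F : Type} [Field F] [Fintype F] {p s e Q : ℕ} [Fact p.Prime]
    [CharP F p] (_ : Q = p ^ s) (_ : Fintype.card F = Q ^ 2) (_ : Q = d * e + 1)
    {f : F[X]} (_ : f.coeff 0 ≠ 0) (_ : f.natDegree ≤ m)
    (_ : ∀ κ : F, κ ≠ 0 →
      Irreducible (X ^ d - C (algebraMap F[X] (RatFunc F) (C κ * f))))
    {α : F} (_ : α ≠ 0) (_ : Q₀ ≤ Q),
    (Finset.univ.filter fun x : F => f.eval x ^ (e * (Q + 1)) = α).card ≤ e * Q + B * Q := by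
  set t := 4 * d * (m + 3) with ht
  refine ⟨1 + t + d * m, 4 * d * (m + 1) + t + d * m + 4 * d, ?_⟩
  intro F _ _ p s e Q _ _ hQ hcard he f hf0 hm hirr α hα hlarge
  obtain ⟨A, hA1, hA2⟩ : ∃ A, 2 * d * (A + m) < Q ∧ Q ≤ 2 * d * (A + m + 1) := by
    refine ⟨(Q - 1) / (2 * d) - m, ?_⟩
    have h1 := Nat.div_add_mod (Q - 1) (2 * d)
    have h2 := Nat.mod_lt (Q - 1) (show 0 < 2 * d by omega)
    have h3 : m ≤ (Q - 1) / (2 * d) := by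
      rw [Nat.le_div_iff_mul_le (by omega)]
      have : m * (2 * d) ≤ 4 * d * (m + 1) := by nlinarith
      have : 1 ≤ 4 * d := by omega
      omega
    rw [Nat.sub_add_cancel h3]
    constructor
    · omega
    · rw [mul_add]; omega
  have hAQ : Q ≤ 4 * d * A := by
    have : 4 * d * (m + 1) ≤ Q := by omega
    nlinarith
  refine (card_pow_eval_eq_le hQ hcard hd he hf0 hm hirr hα (J := e + t) hA1 ?_).trans ?_
  · have h1 : A * (e + t) * d + A = A * Q + A * (t * d) := by rw [he]; ring
    have h2 : Q * (m + 3) ≤ A * t := by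
      calc Q * (m + 3) ≤ 4 * d * A * (m + 3) := Nat.mul_le_mul_right _ hAQ
        _ = A * t := by rw [ht]; ring
    have h3 : e ≤ Q := by nlinarith [Nat.pos_of_ne_zero hd]
    have h4 : 2 * A ≤ Q := by nlinarith [Nat.pos_of_ne_zero hd]
    have h5 : A * t ≤ A * (t * d) := Nat.mul_le_mul_left _ (Nat.le_mul_of_pos_right _ (by omega))
    have h6 : t + m * d + 1 ≤ Q := by nlinarith
    nlinarith
  · have h3 : A ≤ Q := by nlinarith [Nat.pos_of_ne_zero hd]
    nlinarith

open Polynomial in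
theorem count_roots_prod_X_add_C_pow {F : Type*} [Field F] {n : ℕ} {μ : Fin n → F}
    (hμ : Function.Injective μ) (k : Fin n → ℕ) (j : Fin n) :
    (∏ i, (X + C (μ i)) ^ k i).roots.count (-μ j) = k j := by
  rw [roots_prod _ _ (Finset.prod_ne_zero_iff.2 fun i _ => pow_ne_zero _ (X_add_C_ne_zero _))]
  simp only [Multiset.count_bind, roots_pow, roots_X_add_C, Multiset.count_nsmul]
  change ∑ i, _ = _
  rw [Finset.sum_eq_single j]
  · simp
  · intro i _ hij
    simpa [Multiset.count_singleton] using fun h => absurd (hμ h).symm hij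
  · simp

open Polynomial in
theorem irreducible_X_pow_sub_C_prod {F : Type*} [Field F] {n d : ℕ} (hd : d ≠ 0) {μ : Fin n → F}
    (hμ : Function.Injective μ) (k : Fin n → ℕ)
    (hk : ∀ l : ℕ, l.Prime → l ∣ d → ∃ j, ¬ l ∣ k j) {κ : F} (hκ : κ ≠ 0) :
    Irreducible (X ^ d -
      C (algebraMap F[X] (RatFunc F) (C κ * ∏ i, (X + C (μ i)) ^ k i))) := by
  have key : ∀ l : ℕ, l.Prime → l ∣ d → ∀ κ : F, κ ≠ 0 → ∀ b : RatFunc F,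
      b ^ l ≠ algebraMap F[X] (RatFunc F) (C κ * ∏ i, (X + C (μ i)) ^ k i) := by
    intro l hl hld κ hκ b hb
    obtain ⟨g, rfl⟩ := IsIntegrallyClosed.exists_algebraMap_eq_of_isIntegral_pow (R := F[X])
      hl.pos (hb ▸ isIntegral_algebraMap)
    rw [← map_pow] at hb
    have hb := IsFractionRing.injective F[X] (RatFunc F) hb
    obtain ⟨j, hj⟩ := hk l hl hld
    apply hj
    have h1 := congrArg (fun P => P.roots.count (-μ j)) hb
    simp only [roots_C_mul _ hκ, count_roots_prod_X_add_C_pow hμ, roots_pow,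
      Multiset.count_nsmul] at h1
    exact ⟨_, h1.symm⟩
  refine X_pow_sub_C_irreducible_of_forall_prime hd fun l hl hld b => ⟨key l hl hld κ hκ b, ?_⟩
  have := key l hl hld (-κ) (neg_ne_zero.2 hκ) b
  simpa using this

theorem MulChar.pow_eq_one_of_apply_eq_one {F : Type*} [Field F] [Fintype F] {η : MulChar F ℂ}
    {w : ℕ} (hw : Fintype.card F - 1 ∣ orderOf η * w) {y : F} (hy : η y = 1) : y ^ w = 1 := by
  have hy0 : y ≠ 0 := by
    rintro rfl
    simp at hy
  obtain ⟨g, hg⟩ := IsCyclic.exists_generator (α := Fˣ)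
  obtain ⟨i, hi⟩ := (mem_powers_iff_mem_zpowers).2 (hg (Units.mk0 y hy0))
  have hi : g ^ i = Units.mk0 y hy0 := hi
  have hyg : y = (g : F) ^ i := by
    have := congrArg Units.val hi
    simpa using this.symm
  have h1 : η ^ i = 1 := by
    rw [MulChar.eq_iff hg, MulChar.pow_apply_coe, ← map_pow, ← hyg, hy]
    simp
  obtain ⟨t, rfl⟩ := orderOf_dvd_of_pow_eq_one h1
  obtain ⟨r, hr⟩ := hw
  rw [hyg, ← pow_mul, show orderOf η * t * w = (Fintype.card F - 1) * (r * t) by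
    rw [mul_right_comm, hr, mul_assoc], pow_mul, FiniteField.pow_card_sub_one_eq_one _ g.ne_zero,
    one_pow]

open Polynomial in
/-- Character sums of split polynomials over `F_{Q²}` are `O(Q)`. -/
theorem norm_sum_mulChar_prod_le (n d : ℕ) (hd : 2 ≤ d) (k : Fin n → ℕ)
    (hk : ∀ l : ℕ, l.Prime → l ∣ d → ∃ j, ¬ l ∣ k j) : ∃ B Q₀ : ℕ,
    ∀ {F : Type} [Field F] [Fintype F] {p s Q : ℕ} [Fact p.Prime]
    [CharP F p] (_ : Q = p ^ s) (_ : Fintype.card F = Q ^ 2) (_ : d ∣ Q - 1)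
    {η : MulChar F ℂ} (_ : orderOf η = d) {μ : Fin n → F} (_ : Function.Injective μ)
    (_ : Q₀ ≤ Q), ‖∑ x : F, η (∏ j, (x + μ j) ^ k j)‖ ≤ B * Q := by
  set m := ∑ j, k j with hm
  obtain ⟨B, Q₀, hB⟩ := card_pow_eval_eq_le_of_large d m (by omega)
  refine ⟨d * B + m, Q₀ + n + 1, ?_⟩
  intro F _ _ p s Q _ _ hQ hcard hdQ η hη μ hμ hlarge
  obtain ⟨e, he⟩ := hdQ
  have he : Q = d * e + 1 := by omega
  obtain ⟨c, hc⟩ : ∃ c : F, ∀ j, c + μ j ≠ 0 := by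
    by_contra! h
    have hsurj : Function.Surjective fun j => -μ j := fun c => by
      obtain ⟨j, hj⟩ := h c
      exact ⟨j, by simp [← eq_neg_of_add_eq_zero_left hj]⟩
    have := Fintype.card_le_of_surjective _ hsurj
    rw [hcard, Fintype.card_fin] at this
    nlinarith
  set ν : Fin n → F := fun j => c + μ j with hν
  have hνinj : Function.Injective ν := fun i j h => hμ (add_left_cancel h)
  set f : F[X] := ∏ j, (X + C (ν j)) ^ k j with hf
  have hfeval : ∀ x, f.eval x = ∏ j, (x + ν j) ^ k j := fun x => by
    simp [hf, eval_prod]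
  have hf0 : f.coeff 0 ≠ 0 := by
    rw [coeff_zero_eq_eval_zero, hfeval, Finset.prod_ne_zero_iff]
    exact fun j _ => pow_ne_zero _ (by simpa using hc j)
  have hfne : f ≠ 0 := fun h => hf0 (by simp [h])
  have hfdeg : f.natDegree ≤ m := by
    refine (natDegree_prod_le _ _).trans (Finset.sum_le_sum fun j _ => ?_)
    exact natDegree_pow_le.trans (by simp)
  have htrans : ∑ x : F, η (∏ j, (x + μ j) ^ k j) = ∑ x : F, η (f.eval x) := by
    rw [← Equiv.sum_comp (Equiv.addRight c)]
    refine Finset.sum_congr rfl fun x _ => ?_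
    rw [hfeval]
    simp [hν, add_assoc]
  rw [htrans]
  set M : ℝ := e * Q + B * Q with hM
  let N : ℂ → ℕ := fun ζ => (Finset.univ.filter fun x : F => η (f.eval x) = ζ).card
  have hN : ∀ ζ : ℂ, ζ ≠ 0 → (N ζ : ℝ) ≤ M := by
    intro ζ hζ
    by_cases hex : ∃ u : F, η u = ζ
    · obtain ⟨u, hu⟩ := hex
      have hu0 : u ≠ 0 := by
        rintro rfl
        apply hζ
        rw [← hu, MulChar.map_zero]
      have h1 := hB hQ hcard he hf0 hfdeg
        (fun κ hκ => irreducible_X_pow_sub_C_prod (by omega) hνinj k hk hκ)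
        (α := u ^ (e * (Q + 1))) (pow_ne_zero _ hu0) (by omega)
      have h2 : N ζ ≤ e * Q + B * Q := by
        refine (Finset.card_le_card fun x hx => ?_).trans h1
        simp only [Finset.mem_filter, Finset.mem_univ, true_and] at hx ⊢
        have h3 : η (f.eval x / u) = 1 := by
          rw [div_eq_mul_inv, map_mul, hx, ← hu, ← map_mul, mul_inv_cancel₀ hu0, map_one]
        have h4 := MulChar.pow_eq_one_of_apply_eq_one (w := e * (Q + 1)) (by
          rw [hcard, hη, he]
          refine ⟨1, ?_⟩
          rw [mul_one, Nat.sub_eq_of_eq_add]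
          ring) h3
        rwa [div_pow, div_eq_one_iff_eq (pow_ne_zero _ hu0)] at h4
      rw [hM]
      exact_mod_cast h2
    · have : N ζ = 0 := by
        rw [Finset.card_eq_zero, Finset.filter_eq_empty_iff]
        exact fun x _ hx => hex ⟨_, hx⟩
      rw [this, hM, Nat.cast_zero]
      positivity
  have hζ := Complex.isPrimitiveRoot_exp d (by omega)
  set ζ := Complex.exp (2 * Real.pi * Complex.I / d) with hζdef
  have hζ0 : ζ ≠ 0 := Complex.exp_ne_zero _
  have hpow : ∀ y : F, y ≠ 0 → ∃ i < d, ∀ j < d, η y = ζ ^ j ↔ i = j := by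
    intro y hy
    have h1 : η y ^ d = 1 := by
      rw [← MulChar.pow_apply' _ (by omega), ← hη, pow_orderOf_eq_one]
      exact MulChar.one_apply (isUnit_iff_ne_zero.2 hy)
    have : NeZero d := ⟨by omega⟩
    obtain ⟨i, hi, hieq⟩ := hζ.eq_pow_of_pow_eq_one h1
    refine ⟨i, hi, fun j hj => ⟨fun h => hζ.pow_inj hi hj (hieq.trans h), ?_⟩⟩
    rintro rfl
    exact hieq.symm
  have hS : ∑ x : F, η (f.eval x) = ∑ i ∈ Finset.range d, ζ ^ i * N (ζ ^ i) := by
    simp only [N, Finset.card_filter, Nat.cast_sum, Finset.mul_sum]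
    rw [Finset.sum_comm]
    refine Finset.sum_congr rfl fun x _ => ?_
    by_cases hx : f.eval x = 0
    · rw [hx, MulChar.map_zero]
      refine (Finset.sum_eq_zero fun i _ => ?_).symm
      simp [(pow_ne_zero i hζ0).symm]
    · obtain ⟨i, hi, hiff⟩ := hpow _ hx
      rw [Finset.sum_eq_single i, if_pos ((hiff i hi).2 rfl)]
      · simpa using (hiff i hi).2 rfl
      · intro j hj hji
        rw [if_neg fun h => hji ((hiff j (Finset.mem_range.1 hj)).1 h).symm]
        simp
      · exact fun h => absurd (Finset.mem_range.2 hi) h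
  have htotal : (Q : ℝ) ^ 2 - m ≤ ∑ i ∈ Finset.range d, (N (ζ ^ i) : ℝ) := by
    have h1 : Fintype.card F ≤ ∑ i ∈ Finset.range d, N (ζ ^ i) + f.roots.toFinset.card := by
      rw [← Finset.card_univ]
      refine (Finset.card_le_card (t := ((Finset.range d).biUnion fun i =>
        Finset.univ.filter fun x : F => η (f.eval x) = ζ ^ i) ∪ f.roots.toFinset)
        fun x _ => ?_).trans ((Finset.card_union_le _ _).trans
          (Nat.add_le_add_right Finset.card_biUnion_le _))
      rw [Finset.mem_union, Multiset.mem_toFinset, mem_roots hfne]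
      by_cases hx : f.eval x = 0
      · exact Or.inr hx
      · obtain ⟨i, hi, hiff⟩ := hpow _ hx
        exact Or.inl (Finset.mem_biUnion.2 ⟨i, Finset.mem_range.2 hi, by
          simpa using (hiff i hi).2 rfl⟩)
    have h2 := (Multiset.toFinset_card_le f.roots).trans ((card_roots' f).trans hfdeg)
    have h3 : Q ^ 2 ≤ ∑ i ∈ Finset.range d, N (ζ ^ i) + m := by omega
    rw [sub_le_iff_le_add]
    exact_mod_cast h3
  have hS' : ∑ x : F, η (f.eval x)
      = ∑ i ∈ Finset.range d, ζ ^ i * ((N (ζ ^ i) : ℝ) - M : ℝ) := by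
    have h0 : ∑ i ∈ Finset.range d, ζ ^ i * (M : ℂ) = 0 := by
      rw [← Finset.sum_mul, hζ.geom_sum_eq_zero (by omega), zero_mul]
    rw [hS, ← sub_zero (∑ i ∈ Finset.range d, _), ← h0, ← Finset.sum_sub_distrib]
    exact Finset.sum_congr rfl fun i _ => by push_cast; ring
  rw [hS']
  calc ‖∑ i ∈ Finset.range d, ζ ^ i * ((N (ζ ^ i) : ℝ) - M : ℝ)‖
      ≤ ∑ i ∈ Finset.range d, (M - N (ζ ^ i)) := by
        refine norm_sum_le_of_le _ fun i _ => ?_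
        rw [norm_mul, norm_pow, hζ.norm'_eq_one (by omega), one_pow, one_mul, Complex.norm_real,
          Real.norm_eq_abs, abs_sub_comm, abs_of_nonneg (sub_nonneg.2 (hN _ (pow_ne_zero _ hζ0)))]
    _ = d * M - ∑ i ∈ Finset.range d, (N (ζ ^ i) : ℝ) := by
        rw [Finset.sum_sub_distrib]; simp
    _ ≤ d * M - (Q ^ 2 - m) := by linarith
    _ ≤ (d * B + m : ℕ) * Q := by
        have h1 : (Q : ℝ) = d * e + 1 := by exact_mod_cast he
        have h2 : (1 : ℝ) ≤ Q := by
          rw [h1]; have : (0 : ℝ) ≤ d * e := by positivity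
          linarith
        have h3 : (0 : ℝ) ≤ m := by positivity
        push_cast
        rw [hM]
        have h4 : (d : ℝ) * (e * Q) = (Q - 1) * Q := by rw [← mul_assoc]; congr 1; linarith
        nlinarith

section MonicSums

open Polynomial

/-- The multiplicative function `g ↦ χ (∏ j, g (m j) ^ k j)` on polynomials. -/
def charEvalHom {K : Type*} [Field K] {n : ℕ} (χ : MulChar K ℂ) (m : Fin n → K) (k : Fin n → ℕ) :
    K[X] →* ℂ where
  toFun g := χ (∏ j, g.eval (m j) ^ k j)
  map_one' := by simp
  map_mul' g h := by simp [mul_pow, Finset.prod_mul_distrib]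

theorem charEvalHom_apply {K : Type*} [Field K] {n : ℕ} (χ : MulChar K ℂ) (m : Fin n → K) (k : Fin n → ℕ)
    (g : K[X]) :
    charEvalHom χ m k g = χ (∏ j, g.eval (m j) ^ k j) := rfl

variable {K : Type*} [Field K] [Fintype K]

theorem finite_setOf_natDegree_le (r : ℕ) : {g : K[X] | g.natDegree ≤ r}.Finite := by
  refine Set.Finite.of_injOn (f := fun g : K[X] => fun i : Fin (r + 1) => g.coeff i)
    (t := Set.univ) (fun _ _ => Set.mem_univ _) ?_ Set.finite_univ
  intro g hg h hh hgh
  ext i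
  rcases le_or_gt i r with hi | hi
  · exact congrFun hgh ⟨i, by omega⟩
  · rw [coeff_eq_zero_of_natDegree_lt (lt_of_le_of_lt hg hi),
      coeff_eq_zero_of_natDegree_lt (lt_of_le_of_lt hh hi)]

variable (K) in
/-- The monic polynomials of degree `r` over a finite field. -/
def monicFinset (r : ℕ) : Finset K[X] :=
  (finite_setOf_natDegree_le r).toFinset.filter fun g => g.Monic ∧ g.natDegree = r

variable (K) in
/-- The monic irreducible polynomials whose degree is at most `r`. -/
def irredFinset (r : ℕ) : Finset K[X] :=
  (finite_setOf_natDegree_le r).toFinset.filter fun g => g.Monic ∧ Irreducible g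

theorem mem_monicFinset {r : ℕ} {g : K[X]} : g ∈ monicFinset K r ↔ g.Monic ∧ g.natDegree = r := by
  simp only [monicFinset, Finset.mem_filter, Set.Finite.mem_toFinset, Set.mem_ofPred_eq]
  exact ⟨fun h => h.2, fun h => ⟨h.2.le, h⟩⟩

theorem mem_irredFinset {r : ℕ} {g : K[X]} :
    g ∈ irredFinset K r ↔ g.natDegree ≤ r ∧ g.Monic ∧ Irreducible g := by
  simp [irredFinset]

/-- The sum of `ψ` over the monic polynomials of degree `r`. -/
def monicSum (ψ : K[X] →* ℂ) (r : ℕ) : ℂ := ∑ g ∈ monicFinset K r, ψ g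

/-- The sum of `(deg P) ψ(P) ^ (t / deg P)` over the monic irreducible `P` with `deg P ∣ t`. -/
def primePowerSum (ψ : K[X] →* ℂ) (t : ℕ) : ℂ :=
  ∑ P ∈ irredFinset K t with P.natDegree ∣ t, (P.natDegree : ℂ) * ψ P ^ (t / P.natDegree)

theorem monicSum_zero (ψ : K[X] →* ℂ) : monicSum ψ 0 = 1 := by
  have : monicFinset K 0 = {1} := by
    ext g
    rw [mem_monicFinset, Finset.mem_singleton]
    refine ⟨fun h => h.1.natDegree_eq_zero.1 h.2, ?_⟩
    rintro rfl
    simp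
  simp [monicSum, this]

theorem monicSum_one (ψ : K[X] →* ℂ) : monicSum ψ 1 = ∑ x : K, ψ (X + C x) := by
  symm
  refine Finset.sum_bij (fun x _ => X + C x) (fun x _ => ?_) (fun x _ y _ h => ?_)
    (fun g hg => ?_) fun _ _ => rfl
  · exact mem_monicFinset.2 ⟨monic_X_add_C x, natDegree_X_add_C x⟩
  · exact C_injective (add_left_cancel h)
  · obtain ⟨h1, h2⟩ := mem_monicFinset.1 hg
    refine ⟨g.coeff 0, Finset.mem_univ _, ?_⟩
    conv_rhs => rw [eq_X_add_C_of_natDegree_le_one h2.le]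
    have : g.coeff 1 = 1 := by rw [← h2]; exact h1
    simp [this]

theorem natDegree_eq_sum_irreducible_pow_dvd {r : ℕ} {g : K[X]} (hg : g ∈ monicFinset K r) :
    r = ∑ x ∈ irredFinset K r ×ˢ Finset.Icc 1 r with x.1 ^ x.2 ∣ g, x.1.natDegree := by
  obtain ⟨hm, hr⟩ := mem_monicFinset.1 hg
  set s := UniqueFactorizationMonoid.normalizedFactors g with hs
  have hmem : ∀ P ∈ s, P.natDegree ≤ r ∧ P.Monic ∧ Irreducible P := fun P hP => by
    refine ⟨?_, ?_, UniqueFactorizationMonoid.irreducible_of_normalized_factor P hP⟩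
    · rw [← hr]
      exact natDegree_le_of_dvd (UniqueFactorizationMonoid.dvd_of_mem_normalizedFactors hP)
        hm.ne_zero
    · rw [← UniqueFactorizationMonoid.normalize_normalized_factor P hP]
      exact monic_normalize
        (UniqueFactorizationMonoid.irreducible_of_normalized_factor P hP).ne_zero
  have hprod : s.prod = g := by
    rw [hs, UniqueFactorizationMonoid.prod_normalizedFactors_eq hm.ne_zero, hm.normalize_eq_self]
  have hdeg : r = ∑ P ∈ irredFinset K r, s.count P * P.natDegree := by
    rw [← hr]
    conv_lhs => rw [← hprod, natDegree_multiset_prod _ fun h => (hmem 0 h).2.2.ne_zero rfl,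
      Finset.sum_multiset_map_count]
    refine (Finset.sum_subset (fun P hP => ?_) fun P _ hP => ?_)
    · rw [hr]
      exact mem_irredFinset.2 (hmem P (by simpa using hP))
    · rw [Multiset.count_eq_zero_of_notMem (by simpa using hP), zero_smul]
  have hdvd : ∀ P ∈ irredFinset K r, ∀ e : ℕ, P ^ e ∣ g ↔ e ≤ s.count P := by
    intro P hP e
    obtain ⟨_, h2, h3⟩ := mem_irredFinset.1 hP
    rw [pow_dvd_iff_le_emultiplicity,
      UniqueFactorizationMonoid.emultiplicity_eq_count_normalizedFactors h3 hm.ne_zero,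
      h2.normalize_eq_self, Nat.cast_le]
  conv_lhs => rw [hdeg]
  rw [Finset.sum_filter, Finset.sum_product]
  refine Finset.sum_congr rfl fun P hP => ?_
  rw [← Finset.sum_filter]
  change _ = ∑ e ∈ Finset.Icc 1 r with P ^ e ∣ g, P.natDegree
  rw [Finset.sum_const, smul_eq_mul]
  congr 1
  have hle : s.count P ≤ r := by
    have h1 : s.count P * P.natDegree ≤ r := by
      conv_rhs => rw [hdeg]
      exact Finset.single_le_sum (f := fun P => s.count P * P.natDegree)
        (fun _ _ => Nat.zero_le _) hP
    exact (Nat.le_mul_of_pos_right _ (mem_irredFinset.1 hP).2.2.natDegree_pos).trans h1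
  have : (Finset.Icc 1 r).filter (fun e => P ^ e ∣ g) = Finset.Icc 1 (s.count P) := by
    ext e
    rw [Finset.mem_filter, hdvd P hP, Finset.mem_Icc, Finset.mem_Icc]
    omega
  rw [this]
  simp

theorem mul_monicSum_eq (ψ : K[X] →* ℂ) (r : ℕ) :
    (r : ℂ) * monicSum ψ r = ∑ a ∈ Finset.HasAntidiagonal.antidiagonal r with a.1 < r,
      monicSum ψ a.1 * primePowerSum ψ a.2 := by
  have hL : (r : ℂ) * monicSum ψ r
      = ∑ x ∈ (monicFinset K r).sigma fun g =>
          (irredFinset K r ×ˢ Finset.Icc 1 r).filter fun x => x.1 ^ x.2 ∣ g,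
        (x.2.1.natDegree : ℂ) * ψ x.1 := by
    rw [monicSum, Finset.mul_sum, Finset.sum_sigma]
    refine Finset.sum_congr rfl fun g hg => ?_
    conv_lhs => rw [natDegree_eq_sum_irreducible_pow_dvd hg]
    rw [Nat.cast_sum, Finset.sum_mul]
  have hR : ∑ a ∈ Finset.HasAntidiagonal.antidiagonal r with a.1 < r,
      monicSum ψ a.1 * primePowerSum ψ a.2
      = ∑ x ∈ ((Finset.HasAntidiagonal.antidiagonal r).filter fun a => a.1 < r).sigma fun a =>
          monicFinset K a.1 ×ˢ (irredFinset K a.2).filter fun P => P.natDegree ∣ a.2,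
        ψ x.2.1 * ((x.2.2.natDegree : ℂ) * ψ x.2.2 ^ (x.1.2 / x.2.2.natDegree)) := by
    rw [Finset.sum_sigma]
    refine Finset.sum_congr rfl fun a _ => ?_
    rw [monicSum, primePowerSum, Finset.sum_mul_sum, Finset.sum_product]
  rw [hL, hR]
  refine Finset.sum_bij'
    (fun x _ => ⟨(r - x.2.2 * x.2.1.natDegree, x.2.2 * x.2.1.natDegree),
      (x.1 /ₘ (x.2.1 ^ x.2.2), x.2.1)⟩)
    (fun x _ => ⟨x.2.2 ^ (x.1.2 / x.2.2.natDegree) * x.2.1,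
      (x.2.2, x.1.2 / x.2.2.natDegree)⟩) ?_ ?_ ?_ ?_ ?_
  · rintro ⟨g, P, e⟩ hx
    simp only [Finset.mem_sigma, Finset.mem_filter, Finset.mem_product, mem_monicFinset,
      mem_irredFinset, Finset.mem_Icc, Finset.HasAntidiagonal.mem_antidiagonal] at hx ⊢
    obtain ⟨⟨hm, hr⟩, ⟨⟨hP1, hP2, hP3⟩, he1, he2⟩, hdvd⟩ := hx
    obtain ⟨h, rfl⟩ := hdvd
    have hh : h.Monic := (hP2.pow e).of_mul_monic_left hm
    rw [(hP2.pow e).natDegree_mul hh, hP2.natDegree_pow] at hr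
    have hpos := Nat.mul_pos he1 hP3.natDegree_pos
    rw [mul_divByMonic_cancel_left _ (hP2.pow e)]
    refine ⟨⟨by omega, by omega⟩, ⟨hh, by omega⟩, ⟨?_, hP2, hP3⟩, Dvd.intro_left _ rfl⟩
    exact Nat.le_mul_of_pos_left _ he1
  · rintro ⟨⟨a, b⟩, h, P⟩ hx
    simp only [Finset.mem_sigma, Finset.mem_filter, Finset.mem_product, mem_monicFinset,
      mem_irredFinset, Finset.mem_Icc, Finset.HasAntidiagonal.mem_antidiagonal] at hx ⊢
    obtain ⟨⟨hab, har⟩, ⟨hh, hd⟩, ⟨hP1, hP2, hP3⟩, e, rfl⟩ := hx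
    have hpos := hP3.natDegree_pos
    have he : 0 < e := Nat.pos_of_ne_zero (by rintro rfl; simp at hab; omega)
    have h1 : e ≤ P.natDegree * e := Nat.le_mul_of_pos_left _ hpos
    rw [Nat.mul_div_cancel_left _ hpos, (hP2.pow e).natDegree_mul hh, hP2.natDegree_pow, mul_comm e]
    exact ⟨⟨(hP2.pow e).mul hh, by omega⟩, ⟨⟨by omega, hP2, hP3⟩, he, by omega⟩, Dvd.intro _ rfl⟩
  · rintro ⟨g, P, e⟩ hx
    simp only [Finset.mem_sigma, Finset.mem_filter, Finset.mem_product, mem_monicFinset,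
      mem_irredFinset, Finset.mem_Icc] at hx ⊢
    obtain ⟨⟨hm, hr⟩, ⟨⟨hP1, hP2, hP3⟩, he1, he2⟩, hdvd⟩ := hx
    obtain ⟨h, rfl⟩ := hdvd
    rw [mul_divByMonic_cancel_left _ (hP2.pow e), Nat.mul_div_cancel _ hP3.natDegree_pos]
  · rintro ⟨⟨a, b⟩, h, P⟩ hx
    simp only [Finset.mem_sigma, Finset.mem_filter, Finset.mem_product, mem_monicFinset,
      mem_irredFinset, Finset.HasAntidiagonal.mem_antidiagonal] at hx ⊢
    obtain ⟨⟨hab, har⟩, ⟨hh, hd⟩, ⟨hP1, hP2, hP3⟩, e, rfl⟩ := hx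
    rw [Nat.mul_div_cancel_left _ hP3.natDegree_pos, mul_divByMonic_cancel_left _ (hP2.pow e),
      mul_comm e, show r - P.natDegree * e = a by omega]
  · rintro ⟨g, P, e⟩ hx
    simp only [Finset.mem_sigma, Finset.mem_filter, Finset.mem_product, mem_monicFinset,
      mem_irredFinset, Finset.mem_Icc] at hx ⊢
    obtain ⟨⟨hm, hr⟩, ⟨⟨hP1, hP2, hP3⟩, he1, he2⟩, hdvd⟩ := hx
    obtain ⟨h, rfl⟩ := hdvd
    rw [mul_divByMonic_cancel_left _ (hP2.pow e), Nat.mul_div_cancel _ hP3.natDegree_pos, map_mul,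
      map_pow]
    ring

theorem monicSum_charEvalHom_eq_zero {n r : ℕ} {χ : MulChar K ℂ} {m : Fin n → K}
    (hm : Function.Injective m) {k : Fin n → ℕ} (j : Fin n) (hj : χ ^ k j ≠ 1) (hr : n ≤ r) :
    monicSum (charEvalHom χ m k) r = 0 := by
  obtain ⟨u, hu⟩ := MulChar.ne_one_iff.1 hj
  set L : K[X] := Lagrange.basis Finset.univ m j with hL
  have hLj : L.eval (m j) = 1 := Lagrange.eval_basis_self hm.injOn (Finset.mem_univ j)
  have hLi : ∀ i, i ≠ j → L.eval (m i) = 0 := fun i hi =>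
    Lagrange.eval_basis_of_ne hi.symm (Finset.mem_univ i)
  have hLdeg : L.degree < r := by
    rw [hL, Lagrange.degree_basis hm.injOn (Finset.mem_univ j), Finset.card_univ, Fintype.card_fin]
    exact_mod_cast (show n - 1 < r by have := j.pos; omega)
  let f : K → K[X] → K[X] := fun c g => g + C ((c - 1) * g.eval (m j)) * L
  have hfmem : ∀ c, ∀ g ∈ monicFinset K r, f c g ∈ monicFinset K r := by
    intro c g hg
    obtain ⟨h1, h2⟩ := mem_monicFinset.1 hg
    have hlt : (C ((c - 1) * g.eval (m j)) * L).degree < g.degree := by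
      rw [degree_eq_natDegree h1.ne_zero, h2]
      rw [← smul_eq_C_mul]
      exact (degree_smul_le _ _).trans_lt hLdeg
    exact mem_monicFinset.2 ⟨h1.add_of_left hlt, by
      rw [natDegree_add_eq_left_of_degree_lt hlt, h2]⟩
  have hfj : ∀ c g, (f c g).eval (m j) = c * g.eval (m j) := fun c g => by
    simp only [f, eval_add, eval_mul, eval_C, hLj]
    ring
  have hfi : ∀ c g i, i ≠ j → (f c g).eval (m i) = g.eval (m i) := fun c g i hi => by
    simp [f, hLi i hi]
  have hff : ∀ c c' g, f c (f c' g) = f (c * c') g := fun c c' g => by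
    change f c' g + C ((c - 1) * (f c' g).eval (m j)) * L = _
    rw [hfj]
    simp only [f, map_mul, map_sub, map_one]
    ring
  have hf1 : ∀ g, f 1 g = g := fun g => by simp [f]
  have hψ : ∀ g, charEvalHom χ m k (f u g) = (χ ^ k j) u * charEvalHom χ m k g := by
    intro g
    rw [charEvalHom_apply, charEvalHom_apply, ← Finset.mul_prod_erase _ _ (Finset.mem_univ j),
      ← Finset.mul_prod_erase Finset.univ (fun i => g.eval (m i) ^ k i) (Finset.mem_univ j), hfj,
      Finset.prod_congr rfl fun i hi => by rw [hfi _ _ _ (Finset.ne_of_mem_erase hi)],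
      mul_pow, mul_assoc, map_mul, map_pow, MulChar.pow_apply_coe]
  have key : monicSum (charEvalHom χ m k) r = (χ ^ k j) u * monicSum (charEvalHom χ m k) r := by
    conv_rhs => rw [monicSum, Finset.mul_sum]
    symm
    refine Finset.sum_bij' (fun g _ => f u g) (fun g _ => f (u⁻¹ : Kˣ) g) (fun g => hfmem _ g)
      (fun g => hfmem _ g) (fun g _ => ?_) (fun g _ => ?_) fun g _ => (hψ g).symm
    · rw [hff, Units.inv_mul, hf1]
    · rw [hff, Units.mul_inv, hf1]
  have : ((χ ^ k j) u - 1) * monicSum (charEvalHom χ m k) r = 0 := by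
    rw [sub_mul, one_mul, ← key, sub_self]
  exact (mul_eq_zero.1 this).resolve_left (sub_ne_zero.2 hu)

end MonicSums

/-- If the power sums of `ω` are `O(b ^ s)` at even exponents `2 * s`, then all `‖ω i‖ ^ 2 ≤ b`. -/
theorem norm_sq_le_of_power_sums_le {n : ℕ} {ω : Fin n → ℂ} {b B : ℝ} (hb : 0 < b) {s₀ : ℕ}
    (h : ∀ s ≥ s₀, ‖∑ i, ω i ^ (2 * s)‖ ≤ B * b ^ s) (i₀ : Fin n) : ‖ω i₀‖ ^ 2 ≤ b := by
  by_contra! hlt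
  let u : Fin n → Circle := fun i => Circle.exp (Complex.arg (ω i))
  have hu : ∀ i, ω i = ‖ω i‖ * (u i : ℂ) := fun i => by
    simp [u, Circle.coe_exp, Complex.norm_mul_exp_arg_mul_I]
  have hopen : {g : Fin n → Circle | ∀ i, 1 / 2 < ((g i : Circle) : ℂ).re} ∈
      nhds (1 : Fin n → Circle) := by
    have : {g : Fin n → Circle | ∀ i, 1 / 2 < ((g i : Circle) : ℂ).re}
        = ⋂ i, {g | 1 / 2 < ((g i : Circle) : ℂ).re} := by ext; simp
    rw [this]
    refine (isOpen_iInter_of_finite fun i => isOpen_lt continuous_const ?_).mem_nhds ?_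
    · exact Complex.continuous_re.comp (continuous_subtype_val.comp (continuous_apply i))
    · simp; norm_num
  have hfreq := (mapClusterPt_one_atTop_pow (u ^ 2)).frequently hopen
  have hgrow : Filter.Tendsto (fun s : ℕ => (‖ω i₀‖ ^ 2 / b) ^ s) Filter.atTop Filter.atTop :=
    tendsto_pow_atTop_atTop_of_one_lt ((one_lt_div hb).2 hlt)
  obtain ⟨s, hs, hs1, hs2⟩ := (hfreq.and_eventually
    ((Filter.eventually_ge_atTop s₀).and (hgrow.eventually_gt_atTop (2 * B)))).exists
  have hs : ∀ i, 1 / 2 < (((u ^ 2) ^ s) i : ℂ).re := hs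
  have hterm : ∀ i, ‖ω i‖ ^ (2 * s) / 2 ≤ (ω i ^ (2 * s)).re := by
    intro i
    have h1 : ω i ^ (2 * s) = ((‖ω i‖ ^ (2 * s) : ℝ) : ℂ) * ((((u ^ 2) ^ s) i : Circle) : ℂ) := by
      conv_lhs => rw [hu i]
      rw [mul_pow, ← pow_mul]
      simp
    rw [h1, Complex.re_ofReal_mul]
    have := hs i
    have h2 : 0 ≤ ‖ω i‖ ^ (2 * s) := by positivity
    nlinarith
  have hlow : ‖ω i₀‖ ^ (2 * s) / 2 ≤ B * b ^ s := by
    refine le_trans ?_ (h s hs1)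
    refine le_trans ?_ (Complex.re_le_norm _)
    rw [Complex.re_sum]
    refine le_trans ?_ (Finset.sum_le_sum fun i _ => hterm i)
    exact Finset.single_le_sum (f := fun i => ‖ω i‖ ^ (2 * s) / 2) (fun i _ => by positivity)
      (Finset.mem_univ i₀)
  rw [div_pow, lt_div_iff₀ (by positivity), ← pow_mul] at hs2
  linarith

open Polynomial in
theorem exists_esymm_eq {n : ℕ} (A : ℕ → ℂ) (h0 : A 0 = 1) (hA : ∀ r, n < r → A r = 0) :
    ∃ ω : Fin n → ℂ, ∀ r,
      A r = (-1) ^ r * MvPolynomial.aeval ω (MvPolynomial.esymm (Fin n) ℂ r) := by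
  set P : ℂ[X] := ∑ k ∈ Finset.range (n + 1), C (A k) * X ^ (n - k) with hP
  have hcoeff : ∀ k ≤ n, P.coeff (n - k) = A k := by
    intro k hk
    simp only [hP, finsetSum_coeff, coeff_C_mul, coeff_X_pow]
    rw [Finset.sum_eq_single k]
    · simp
    · intro i hi hik
      have := Finset.mem_range.1 hi
      simp [show n - k ≠ n - i by omega]
    · intro hk'
      exact absurd (Finset.mem_range.2 (by omega)) hk'
  have hdeg : P.natDegree ≤ n := natDegree_sum_le_of_forall_le _ _ fun k _ =>
    (natDegree_C_mul_X_pow_le _ _).trans (Nat.sub_le _ _)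
  have hlead : P.coeff n = 1 := by simpa [h0] using hcoeff 0 (Nat.zero_le _)
  have hmonic : P.Monic := monic_of_natDegree_le_of_coeff_eq_one n hdeg hlead
  have hdeg' : P.natDegree = n := natDegree_eq_of_le_of_coeff_ne_zero hdeg (by simp [hlead])
  have hcard : Multiset.card P.roots = n := by
    rw [← hdeg']; exact (IsAlgClosed.splits P).natDegree_eq_card_roots.symm
  obtain ⟨ω, hω⟩ : ∃ ω : Fin n → ℂ, (Finset.univ.val.map ω : Multiset ℂ) = P.roots := by
    have key : ∀ m : Multiset ℂ, Multiset.card m = n →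
        ∃ ω : Fin n → ℂ, (Finset.univ.val.map ω : Multiset ℂ) = m := by
      rintro m rfl
      refine ⟨fun i => m.toList.get (i.cast m.length_toList.symm), ?_⟩
      conv_rhs => rw [← Multiset.coe_toList m]
      rw [Fin.univ_val_map]
      congr 1
      refine List.ext_get (by simp) fun i _ _ => by simp
    exact key _ hcard
  refine ⟨ω, fun r => ?_⟩
  rw [MvPolynomial.aeval_esymm_eq_multiset_esymm, hω]
  rcases le_or_gt r n with hr | hr
  · have := coeff_eq_esymm_roots_of_card (p := P) (by rw [hcard, hdeg']) (k := n - r) (by omega)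
    rw [hcoeff r hr, hmonic.leadingCoeff, one_mul, hdeg', Nat.sub_sub_self hr] at this
    exact this
  · rw [hA r hr, Multiset.esymm, Multiset.powersetCard_eq_empty _ (by omega)]
    simp

/-- Bound for the first coefficient of a polynomial `1 + A₁ T + ⋯ + Aₙ Tⁿ` in terms of the growth of
the coefficients of its logarithmic derivative. -/
theorem norm_coeff_one_le {n : ℕ} {A S : ℕ → ℂ} (h0 : A 0 = 1) (hA : ∀ r, n < r → A r = 0)
    (hrec : ∀ r : ℕ, 0 < r → (r : ℂ) * A r
      = ∑ a ∈ Finset.HasAntidiagonal.antidiagonal r with a.1 < r, A a.1 * S a.2)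
    {b B : ℝ} (hb : 0 < b) {s₀ : ℕ} (hS : ∀ s ≥ s₀, ‖S (2 * s)‖ ≤ B * b ^ s) :
    ‖A 1‖ ≤ n * Real.sqrt b := by
  obtain ⟨ω, hω⟩ := exists_esymm_eq A h0 hA
  have hpsum : ∀ r, MvPolynomial.aeval ω (MvPolynomial.psum (Fin n) ℂ r) = ∑ i, ω i ^ r := by
    intro r; simp [MvPolynomial.psum]
  have hnewton : ∀ r : ℕ, (r : ℂ) * A r
      = -∑ a ∈ Finset.HasAntidiagonal.antidiagonal r with a.1 < r, A a.1 * ∑ i, ω i ^ a.2 := by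
    intro r
    have h1 := congrArg (MvPolynomial.aeval ω) (MvPolynomial.mul_esymm_eq_sum (Fin n) ℂ r)
    simp only [map_mul, map_natCast, map_pow, map_neg, map_one, map_sum, hpsum] at h1
    rw [hω, mul_left_comm, h1, ← mul_assoc, ← pow_add,
      show r + (r + 1) = 2 * r + 1 by ring, pow_succ, pow_mul]
    simp only [neg_one_sq, one_pow, one_mul, neg_mul, hω]
  have hSω : ∀ r, 0 < r → S r = -∑ i, ω i ^ r := by
    intro r
    induction r using Nat.strong_induction_on with
    | _ r ih =>
      intro hr
      have h1 : ∑ a ∈ Finset.HasAntidiagonal.antidiagonal r with a.1 < r, A a.1 * (S a.2 + ∑ i, ω i ^ a.2) = 0 := by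
        simp only [mul_add, Finset.sum_add_distrib]
        rw [← hrec r hr, hnewton r]
        ring
      rw [Finset.sum_eq_single (0, r)] at h1
      · rw [h0, one_mul] at h1
        exact eq_neg_of_add_eq_zero_left h1
      · rintro ⟨x, y⟩ hxy hne
        simp only [Finset.mem_filter, Finset.HasAntidiagonal.mem_antidiagonal] at hxy
        have hx : x ≠ 0 := by
          rintro rfl
          exact hne (by simp; omega)
        rw [ih y (by omega) (by omega)]
        simp
      · intro h
        simp [hr] at h
  have hωb : ∀ i, ‖ω i‖ ≤ Real.sqrt b := fun i =>
    Real.le_sqrt_of_sq_le (norm_sq_le_of_power_sums_le (s₀ := s₀ + 1) hb (fun s hs => by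
      have := hS s (by omega)
      rwa [hSω _ (by omega), norm_neg] at this) i)
  have h1 : A 1 = -∑ i, ω i := by
    have := hnewton 1
    rw [Finset.sum_eq_single (0, 1)] at this
    · simpa [h0] using this
    · rintro ⟨x, y⟩ hxy hne
      simp only [Finset.mem_filter, Finset.HasAntidiagonal.mem_antidiagonal] at hxy
      exact absurd (by simp; omega) hne
    · intro h
      simp at h
  rw [h1, norm_neg]
  exact (norm_sum_le_of_le _ fun i _ => hωb i).trans (by simp)

section FieldSums

open Polynomial Module

variable {K F : Type*} [Field K] [Field F] [Algebra K F]

theorem card_minpoly_eq [Finite K] [Fintype F] {P : K[X]} (hm : P.Monic) (hP : Irreducible P)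
    (hdvd : P.natDegree ∣ finrank K F) :
    (Finset.univ.filter fun x : F => minpoly K x = P).card = P.natDegree := by
  have : Fact (Irreducible P) := ⟨hP⟩
  have : Finite (AdjoinRoot P) := by
    have : FiniteDimensional K (AdjoinRoot P) := (AdjoinRoot.powerBasis hP.ne_zero).finite
    exact Module.finite_of_finite K
  have hfr : finrank K (AdjoinRoot P) = P.natDegree := by
    rw [(AdjoinRoot.powerBasis hP.ne_zero).finrank, AdjoinRoot.powerBasis_dim]
  rw [← hfr] at hdvd
  obtain ⟨φ⟩ := FiniteField.nonempty_algHom_of_finrank_dvd hdvd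
  have hroot : aeval (φ (AdjoinRoot.root P)) P = 0 := by
    rw [aeval_algHom_apply, AdjoinRoot.aeval_eq, AdjoinRoot.mk_self, map_zero]
  have hmin : minpoly K (φ (AdjoinRoot.root P)) = P :=
    (minpoly.eq_of_irreducible_of_monic hP hroot hm).symm
  have hsplit : (P.map (algebraMap K F)).Splits := by
    rw [← hmin]
    exact Normal.splits inferInstance _
  have hset : (Finset.univ.filter fun x : F => minpoly K x = P) = (P.aroots F).toFinset := by
    ext x
    rw [Finset.mem_filter, Multiset.mem_toFinset, mem_aroots]
    refine ⟨?_, fun h => ⟨Finset.mem_univ _, (minpoly.eq_of_irreducible_of_monic hP h.2 hm).symm⟩⟩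
    rintro ⟨_, rfl⟩
    exact ⟨hP.ne_zero, minpoly.aeval _ _⟩
  rw [hset, Multiset.toFinset_card_of_nodup (nodup_aroots_iff_of_splits hP.ne_zero hsplit |>.2
    (PerfectField.separable_of_irreducible hP)), aroots, ← hsplit.natDegree_eq_card_roots,
    natDegree_map]

variable [FiniteDimensional K F]

theorem norm_algebraMap_sub (t : K) (x : F) : Algebra.norm K (algebraMap K F t - x)
    = (minpoly K x).eval t ^ (finrank K F / (minpoly K x).natDegree) := by
  have hx : IsIntegral K x := Algebra.IsIntegral.isIntegral x
  set g := IntermediateField.AdjoinSimple.gen K x with hg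
  let pb := IntermediateField.adjoin.powerBasis hx
  have hpg : pb.gen = g := IntermediateField.adjoin.powerBasis_gen hx
  have h1 : algebraMap K F t - x = algebraMap (IntermediateField.adjoin K {x}) F
      (algebraMap K _ t - g) := by
    rw [map_sub, IntermediateField.AdjoinSimple.algebraMap_gen,
      ← IsScalarTower.algebraMap_apply]
  have h2 : Algebra.norm K (algebraMap K (IntermediateField.adjoin K {x}) t - g)
      = (minpoly K x).eval t := by
    rw [Algebra.norm_eq_matrix_det pb.basis, map_sub, AlgHom.commutes, ← hpg,
      ← IntermediateField.minpoly_gen K x, ← hg, ← hpg, ← charpoly_leftMulMatrix,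
      Matrix.eval_charpoly]
    rfl
  have h3 : finrank K F / (minpoly K x).natDegree
      = finrank (IntermediateField.adjoin K {x}) F := by
    rw [← IntermediateField.adjoin.finrank hx,
      ← finrank_mul_finrank K (IntermediateField.adjoin K {x}) F, Nat.mul_div_cancel_left _ finrank_pos]
  rw [← Algebra.norm_norm (S := IntermediateField.adjoin K {x}), h1, Algebra.norm_algebraMap,
    map_pow, h2, h3]

theorem sum_minpoly [Fintype K] [Fintype F] (f : K[X] → ℂ) :
    ∑ x : F, f (minpoly K x) = ∑ P ∈ irredFinset K (finrank K F) with P.natDegree ∣ finrank K F,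
      (P.natDegree : ℂ) * f P := by
  have hmaps : ∀ x ∈ (Finset.univ : Finset F), minpoly K x ∈
      (irredFinset K (finrank K F)).filter fun P => P.natDegree ∣ finrank K F := by
    intro x _
    have hx : IsIntegral K x := Algebra.IsIntegral.isIntegral x
    have hdvd := minpoly.degree_dvd hx
    exact Finset.mem_filter.2 ⟨mem_irredFinset.2 ⟨Nat.le_of_dvd finrank_pos hdvd,
      minpoly.monic hx, minpoly.irreducible hx⟩, hdvd⟩
  rw [← Finset.sum_fiberwise_of_maps_to hmaps]
  refine Finset.sum_congr rfl fun P hP => ?_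
  obtain ⟨h1, h2⟩ := Finset.mem_filter.1 hP
  obtain ⟨_, h3, h4⟩ := mem_irredFinset.1 h1
  rw [Finset.sum_congr rfl fun x hx => by rw [(Finset.mem_filter.1 hx).2], Finset.sum_const,
    card_minpoly_eq h3 h4 h2, nsmul_eq_mul]

theorem primePowerSum_charEvalHom [Fintype K] [Fintype F] {n : ℕ} (χ : MulChar K ℂ)
    (m : Fin n → K) (k : Fin n → ℕ) :
    primePowerSum (charEvalHom χ m k) (finrank K F)
      = ∑ x : F, χ (Algebra.norm K (∏ j, (x + algebraMap K F (m j)) ^ k j)) := by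
  rw [primePowerSum, ← sum_minpoly (F := F) fun P => charEvalHom χ m k P ^ (finrank K F / P.natDegree),
    ← Equiv.sum_comp (Equiv.neg F)]
  refine Finset.sum_congr rfl fun x _ => ?_
  rw [charEvalHom_apply, ← map_pow]
  congr 1
  rw [map_prod, ← Finset.prod_pow]
  refine Finset.prod_congr rfl fun j _ => ?_
  rw [map_pow, ← pow_mul, mul_comm, pow_mul]
  congr 1
  rw [← norm_algebraMap_sub]
  simp [sub_eq_add_neg, add_comm]

end FieldSums

/-- The character `χ ∘ N` of an extension field. -/
def MulChar.compNorm {K : Type*} [Field K] (F : Type*) [Field F] [Algebra K F] [FiniteDimensional K F]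
    (χ : MulChar K ℂ) : MulChar F ℂ where
  toMonoidHom := χ.toMonoidHom.comp (Algebra.norm K)
  map_nonunit' a ha := by
    have : a = 0 := by simpa using ha
    subst this
    simp

theorem MulChar.compNorm_apply {K F : Type*} [Field K] [Field F] [Algebra K F]
    [FiniteDimensional K F] (χ : MulChar K ℂ) (x : F) :
    χ.compNorm F x = χ (Algebra.norm K x) := rfl

theorem MulChar.orderOf_compNorm {K F : Type*} [Field K] [Field F] [Algebra K F]
    [FiniteDimensional K F] [Finite F] (χ : MulChar K ℂ) : orderOf (χ.compNorm F) = orderOf χ := by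
  refine orderOf_eq_orderOf_iff.2 fun t => ?_
  rw [MulChar.eq_one_iff, MulChar.eq_one_iff]
  refine ⟨fun h u => ?_, fun h u => ?_⟩
  · obtain ⟨v, rfl⟩ := FiniteField.unitsMap_norm_surjective K F u
    have := h v
    rw [MulChar.pow_apply_coe] at this ⊢
    exact this
  · have := h (Units.map (Algebra.norm K) u)
    rw [MulChar.pow_apply_coe] at this ⊢
    exact this

/-- Weil's bound for multiplicative character sums over a prime field. -/
theorem norm_sum_mulChar_prod_le_sqrt {p n : ℕ} [Fact p.Prime] {χ : MulChar (ZMod p) ℂ}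
    (hd : 2 ≤ orderOf χ) {m : Fin n → ZMod p} (hm : Function.Injective m) (k : Fin n → ℕ)
    (hk : ∀ l : ℕ, l.Prime → l ∣ orderOf χ → ∃ j, ¬ l ∣ k j) :
    ‖∑ x : ZMod p, χ (∏ j, (x + m j) ^ k j)‖ ≤ n * Real.sqrt p := by
  obtain ⟨B, Q₀, hB⟩ := norm_sum_mulChar_prod_le n (orderOf χ) hd k hk
  have hp := (Fact.out : p.Prime)
  obtain ⟨j, hj⟩ : ∃ j, χ ^ k j ≠ 1 := by
    obtain ⟨l, hl, hld⟩ := Nat.exists_prime_and_dvd (show orderOf χ ≠ 1 by omega)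
    obtain ⟨j, hj⟩ := hk l hl hld
    exact ⟨j, fun h => hj (hld.trans (orderOf_dvd_of_pow_eq_one h))⟩
  have h1 : ∑ x : ZMod p, χ (∏ j, (x + m j) ^ k j) = monicSum (charEvalHom χ m k) 1 := by
    rw [monicSum_one]
    refine Finset.sum_congr rfl fun x _ => ?_
    simp [charEvalHom_apply, add_comm]
  rw [h1]
  refine norm_coeff_one_le (S := primePowerSum (charEvalHom χ m k)) (monicSum_zero _)
    (fun r hr => monicSum_charEvalHom_eq_zero hm j hj hr.le) (fun r _ => mul_monicSum_eq _ r)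
    (b := p) (B := B) (by exact_mod_cast hp.pos) (s₀ := Q₀ + 1) fun s hs => ?_
  have hfin : Fintype (GaloisField p (2 * s)) := Fintype.ofFinite _
  have hrank : Module.finrank (ZMod p) (GaloisField p (2 * s)) = 2 * s :=
    GaloisField.finrank p (by omega)
  have hcard : Fintype.card (GaloisField p (2 * s)) = (p ^ s) ^ 2 := by
    rw [← Nat.card_eq_fintype_card, GaloisField.card p _ (by omega), ← pow_mul, mul_comm]
  have hsum := primePowerSum_charEvalHom (F := GaloisField p (2 * s)) χ m k
  rw [hrank] at hsum
  rw [hsum]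
  have hdvd : orderOf χ ∣ p ^ s - 1 := by
    have h2 := χ.orderOf_dvd_card_sub_one
    rw [ZMod.card] at h2
    exact h2.trans (by simpa using Nat.sub_dvd_pow_sub_pow p 1 s)
  have hQ : Q₀ ≤ p ^ s := by
    have := Nat.lt_pow_self hp.one_lt (n := s)
    omega
  have := hB (F := GaloisField p (2 * s)) (η := χ.compNorm _) rfl hcard hdvd
    (MulChar.orderOf_compNorm χ) ((algebraMap (ZMod p) (GaloisField p (2 * s))).injective.comp hm) hQ
  simpa only [Nat.cast_pow, MulChar.compNorm_apply, Function.comp_apply] using this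

theorem norm_sum_mulChar_prod_le_sqrt_of_not_dvd {p n : ℕ} [Fact p.Prime] {χ : MulChar (ZMod p) ℂ}
    {m : Fin n → ZMod p} (hm : Function.Injective m) (k : Fin n → ℕ)
    (hk : ∃ j, ¬ orderOf χ ∣ k j) :
    ‖∑ x : ZMod p, χ (∏ j, (x + m j) ^ k j)‖ ≤ n * Real.sqrt p := by
  have hpos : 0 < orderOf χ := orderOf_pos χ
  set g := Nat.gcd (orderOf χ) (Finset.univ.gcd k) with hg
  have hgpos : 0 < g := Nat.gcd_pos_of_pos_left _ hpos
  have hgd : g ∣ orderOf χ := Nat.gcd_dvd_left _ _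
  have hgk : ∀ j, g ∣ k j := fun j =>
    (Nat.gcd_dvd_right _ _).trans (Finset.gcd_dvd (Finset.mem_univ j))
  choose k' hk' using hgk
  have hord : orderOf (χ ^ g) = orderOf χ / g := orderOf_pow_of_dvd hgpos.ne' hgd
  have hsum : ∀ x, χ (∏ j, (x + m j) ^ k j) = (χ ^ g) (∏ j, (x + m j) ^ k' j) := by
    intro x
    rw [MulChar.pow_apply' _ hgpos.ne', ← map_pow, ← Finset.prod_pow]
    congr 1
    exact Finset.prod_congr rfl fun j _ => by rw [hk' j, ← pow_mul, mul_comm]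
  rw [Finset.sum_congr rfl fun x _ => hsum x]
  refine norm_sum_mulChar_prod_le_sqrt ?_ hm k' fun l hl hld => ?_
  · obtain ⟨j, hj⟩ := hk
    rw [hord]
    have h1 : orderOf χ / g ≠ 1 := by
      intro h
      have h2 : orderOf χ = g := by rw [← Nat.div_mul_cancel hgd, h, one_mul]
      exact hj (h2 ▸ Dvd.intro _ (hk' j).symm)
    have h3 : 0 < orderOf χ / g := Nat.div_pos (Nat.le_of_dvd hpos hgd) hgpos
    omega
  · by_contra! hall
    rw [hord] at hld
    have h1 : g * l ∣ g := by
      refine Nat.dvd_gcd ?_ (Finset.dvd_gcd fun j _ => ?_)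
      · rw [← Nat.mul_div_cancel' hgd]
        exact mul_dvd_mul_left _ hld
      · rw [hk' j]
        exact mul_dvd_mul_left _ (hall j)
    have h2 := Nat.le_of_dvd hgpos h1
    have h3 := hl.two_le
    nlinarith

theorem norm_sum_mulChar_prod_sub_le {p n : ℕ} [Fact p.Prime] {χ : MulChar (ZMod p) ℂ}
    (m : Fin n → ZMod p) :
    ‖∑ x : ZMod p, χ (∏ j, (x + m j) ^ orderOf χ) - p‖ ≤ n := by
  have h1 : ∑ x : ZMod p, χ (∏ j, (x + m j) ^ orderOf χ) - p
      = ∑ x : ZMod p, (χ (∏ j, (x + m j) ^ orderOf χ) - 1) := by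
    simp [ZMod.card]
  have h2 : ∀ x : ZMod p, ‖χ (∏ j, (x + m j) ^ orderOf χ) - 1‖
      ≤ ∑ j, if x = -m j then (1 : ℝ) else 0 := by
    intro x
    rw [Finset.prod_pow, map_pow, ← MulChar.pow_apply' _ (orderOf_pos χ).ne', pow_orderOf_eq_one]
    by_cases h : ∏ j, (x + m j) = 0
    · obtain ⟨j, _, hj⟩ := Finset.prod_eq_zero_iff.1 h
      rw [h, MulChar.map_zero, zero_sub, norm_neg, norm_one]
      have := Finset.single_le_sum (f := fun j => if x = -m j then (1 : ℝ) else 0)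
        (fun i _ => by positivity) (Finset.mem_univ j)
      simpa [eq_neg_of_add_eq_zero_left hj] using this
    · rw [MulChar.one_apply (isUnit_iff_ne_zero.2 h), sub_self, norm_zero]
      positivity
  rw [h1]
  refine (norm_sum_le_of_le _ fun x _ => h2 x).trans ?_
  rw [Finset.sum_comm]
  simp

theorem ite_mulChar_eq {K : Type*} [Field K] {χ : MulChar K ℂ} {d : ℕ} (hd : 0 < d)
    (hχ : χ ^ d = 1) {a : ℂ} (ha : a ^ d = 1) (y : K) :
    (if χ y = a then (1 : ℂ) else 0) = (d : ℂ)⁻¹ * ∑ k : Fin d, (a⁻¹ * χ y) ^ (k + 1 : ℕ) := by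
  have ha0 : a ≠ 0 := by
    rintro rfl
    simp [hd.ne'] at ha
  have hd0 : (d : ℂ) ≠ 0 := by exact_mod_cast hd.ne'
  split_ifs with h
  · simp [h, ha0, hd0]
  · symm
    apply mul_eq_zero_of_right
    rw [Fin.sum_univ_eq_sum_range fun k => (a⁻¹ * χ y) ^ (k + 1)]
    simp only [pow_succ]
    rw [← Finset.sum_mul]
    by_cases hy : y = 0
    · rw [hy, MulChar.map_zero, mul_zero, mul_zero]
    · have hz : a⁻¹ * χ y ≠ 1 := by
        intro h1
        rw [inv_mul_eq_one₀ ha0] at h1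
        exact h h1.symm
      have hz1 : (a⁻¹ * χ y) ^ d = 1 := by
        rw [mul_pow, inv_pow, ha, ← MulChar.pow_apply' _ hd.ne', hχ,
          MulChar.one_apply (isUnit_iff_ne_zero.2 hy)]
        simp
      rw [geom_sum_eq hz, hz1, sub_self, zero_div, zero_mul]

theorem pow_eq_one_of_mem_Ud {d : ℕ} {a : ℂ} (ha : a ∈ Ud d) : a ^ d = 1 := by
  obtain ⟨k, hk, rfl⟩ := ha
  have hd : (d : ℂ) ≠ 0 := by exact_mod_cast (show d ≠ 0 by omega)
  rw [← Complex.exp_nat_mul, mul_div_cancel₀ _ hd, mul_comm, Complex.exp_nat_mul_two_pi_mul_I]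

theorem card_mul_pow_eq {p n d : ℕ} [Fact p.Prime] {χ : MulChar (ZMod p) ℂ} (hd : 0 < d)
    (hχ : χ ^ d = 1) (m : Fin n → ZMod p) {a : Fin n → ℂ} (ha : ∀ j, a j ^ d = 1) :
    (Nat.card {K : ZMod p // ∀ j, χ (K + m j) = a j} : ℂ) * d ^ n
      = ∑ k : Fin n → Fin d, (∏ j, (a j)⁻¹ ^ (k j + 1 : ℕ)) *
          ∑ x : ZMod p, χ (∏ j, (x + m j) ^ (k j + 1 : ℕ)) := by
  have hd0 : (d : ℂ) ≠ 0 := by exact_mod_cast hd.ne'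
  have h1 : (Nat.card {K : ZMod p // ∀ j, χ (K + m j) = a j} : ℂ)
      = ∑ x : ZMod p, ∏ j, if χ (x + m j) = a j then (1 : ℂ) else 0 := by
    rw [Nat.card_eq_fintype_card, Fintype.card_subtype, Finset.card_filter, Nat.cast_sum]
    refine Finset.sum_congr rfl fun x _ => ?_
    rw [Finset.prod_ite_zero]
    simp
  rw [h1, Finset.sum_mul]
  simp only [Finset.mul_sum]
  rw [Finset.sum_comm]
  refine Finset.sum_congr rfl fun x _ => ?_
  rw [Finset.prod_congr rfl fun j _ => ite_mulChar_eq hd hχ (ha j) (x + m j),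
    Finset.prod_mul_distrib, Finset.prod_const, Finset.card_univ, Fintype.card_fin, inv_pow,
    mul_right_comm, inv_mul_cancel₀ (pow_ne_zero _ hd0), one_mul, Fintype.prod_sum]
  refine Finset.sum_congr rfl fun k _ => ?_
  rw [map_prod, ← Finset.prod_mul_distrib]
  exact Finset.prod_congr rfl fun j _ => by rw [mul_pow, map_pow]

/-- Proposition 6.1: for a character `χ (mod p)` of order `d`, uniformly for `n ≤ p`,
pairwise distinct `m₁,…,m_n ∈ F_p` and `(a_j) ∈ U_d^n`, the proportion of `K ∈ F_p`
with `χ(K+m_j) = a_j` for all `j` is `1/dⁿ + O(n/√p)`, with an absolute constant. -/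
theorem character_pattern_count :
    ∃ C > 0, ∀ (p : ℕ) [Fact p.Prime], ∀ χ : DirichletCharacter ℂ p,
      ∀ d : ℕ, orderOf χ = d →
      ∀ n : ℕ, n ≤ p → ∀ m : Fin n → ZMod p, Function.Injective m →
      ∀ a : Fin n → ℂ, (∀ j : Fin n, a j ∈ Ud d) →
        |(Nat.card {K : ZMod p // ∀ j : Fin n, χ (K + m j) = a j} : ℝ) / p
            - 1 / (d : ℝ) ^ n| ≤ C * n / Real.sqrt p := by
  refine ⟨1, one_pos, fun p _ χ d hd n _ m hm a ha => ?_⟩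
  subst hd
  have hdpos : 0 < orderOf χ := orderOf_pos χ
  have hp : (1 : ℝ) ≤ p := by exact_mod_cast (Fact.out : p.Prime).one_lt.le
  have hsq : 1 ≤ Real.sqrt p := Real.one_le_sqrt.2 hp
  have ha1 : ∀ j, a j ^ orderOf χ = 1 := fun j => pow_eq_one_of_mem_Ud (ha j)
  set N := Nat.card {K : ZMod p // ∀ j : Fin n, χ (K + m j) = a j}
  have hN : (N : ℂ) * orderOf χ ^ n = _ := card_mul_pow_eq hdpos (pow_orderOf_eq_one χ) m ha1
  let k₀ : Fin n → Fin (orderOf χ) := fun _ => ⟨orderOf χ - 1, by omega⟩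
  have hterm : ∀ k : Fin n → Fin (orderOf χ), ‖(∏ j, (a j)⁻¹ ^ (k j + 1 : ℕ)) *
      ∑ x : ZMod p, χ (∏ j, (x + m j) ^ (k j + 1 : ℕ)) - if k = k₀ then (p : ℂ) else 0‖
      ≤ n * Real.sqrt p := by
    intro k
    split_ifs with hk
    · subst hk
      have h1 : ∀ j, (k₀ j + 1 : ℕ) = orderOf χ := fun j => Nat.sub_add_cancel hdpos
      simp only [h1, inv_pow, ha1, inv_one, Finset.prod_const_one, one_mul]
      exact (norm_sum_mulChar_prod_sub_le m).trans (le_mul_of_one_le_right (by positivity) hsq)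
    · rw [sub_zero, norm_mul, norm_prod, Finset.prod_eq_one, one_mul]
      · refine norm_sum_mulChar_prod_le_sqrt_of_not_dvd hm (fun j => (k j + 1 : ℕ)) ?_
        by_contra! hall
        refine hk (funext fun j => Fin.ext ?_)
        have h1 := Nat.le_of_dvd (Nat.succ_pos _) (hall j)
        have h2 := (k j).isLt
        change (k j : ℕ) = orderOf χ - 1
        omega
      · intro j _
        rw [norm_pow, norm_inv, Complex.norm_eq_one_of_pow_eq_one (ha1 j) hdpos.ne']
        simp
  have hmain : |(N : ℝ) * orderOf χ ^ n - p| ≤ (orderOf χ : ℝ) ^ n * (n * Real.sqrt p) := by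
    have h1 : (((N : ℝ) * orderOf χ ^ n - p : ℝ) : ℂ)
        = ∑ k : Fin n → Fin (orderOf χ), ((∏ j, (a j)⁻¹ ^ (k j + 1 : ℕ)) *
          ∑ x : ZMod p, χ (∏ j, (x + m j) ^ (k j + 1 : ℕ)) - if k = k₀ then (p : ℂ) else 0) := by
      rw [Finset.sum_sub_distrib, ← hN]
      simp
    rw [← Real.norm_eq_abs, ← Complex.norm_real, h1]
    refine (norm_sum_le_of_le _ fun k _ => hterm k).trans ?_
    simp
  have hdn : (0 : ℝ) < (orderOf χ : ℝ) ^ n := by positivity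
  have hp0 : (0 : ℝ) < p := by linarith
  have h1 : (N : ℝ) / p - 1 / (orderOf χ : ℝ) ^ n
      = (N * orderOf χ ^ n - p) / (p * orderOf χ ^ n) := by
    field_simp
  rw [h1, abs_div, abs_of_pos (mul_pos hp0 hdn), div_le_div_iff₀ (mul_pos hp0 hdn) (by linarith)]
  have h2 := Real.mul_self_sqrt hp0.le
  calc _ ≤ (orderOf χ : ℝ) ^ n * (n * Real.sqrt p) * Real.sqrt p :=
        mul_le_mul_of_nonneg_right hmain (Real.sqrt_nonneg _)
    _ = (orderOf χ : ℝ) ^ n * n * (Real.sqrt p * Real.sqrt p) := by ring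
    _ = _ := by rw [h2]; ring

end
end
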